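/- Let n ≥ 8 and τ be integers with n² − 3n ≤ τ ≤ n² − 2n − 1, and set σ = n² − τ (so 2n + 1 ≤ σ ≤ 3n). Assume σ − 2n ≡ 1 (mod 3) and 3n − σ is odd. Then μ(n,τ) = 2 · 6^{⌊(σ−2n)/3⌋} · 2^{⌊(3n−σ)/2⌋}, and for A ∈ 𝒰(n,τ), per A = μ(n,τ) if and only if A is combinatorially equivalent to one of the following matrices, in each of which the numbers of J_3 and J_2 blocks are chosen so the whole matrix has order n and exactly σ ones: T_{n,σ} = (A₃ ⊕ I_1) ⊕ J_3 ⊕ ⋯ ⊕ J_3 ⊕ J_2 ⊕ ⋯ ⊕ J_2, where A₃ is the 3×3 matrix equal to J_3 except that its (1,1) entry is 0; Q_{n,σ} = (A₄ ⊕ J_2) ⊕ J_3 ⊕ ⋯ ⊕ J_3 ⊕ J_2 ⊕ ⋯ ⊕ J_2, where A₄ is the 4×4 matrix equal to J_4 except that its (1,1) entry is 0; P*_{n,σ}, obtained from a block-diagonal direct sum of copies of J_3 and J_2 of order n with σ − 1 ones by changing an arbitrary entry equal to 0 into a 1. -/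

import Mathlib

open scoped BigOperators

namespace BGM

/-- The permanent of a square matrix with natural number entries. -/
def perm {n : ℕ} (M : Matrix (Fin n) (Fin n) ℕ) : ℕ :=
  ∑ φ : Equiv.Perm (Fin n), ∏ i, M i (φ i)

/-- `M` is a (0,1)-matrix. -/
def IsZeroOne {n : ℕ} (M : Matrix (Fin n) (Fin n) ℕ) : Prop :=
  ∀ i j, M i j = 0 ∨ M i j = 1

/-- The number of entries of `M` equal to `0`. -/
def zeroCount {n : ℕ} (M : Matrix (Fin n) (Fin n) ℕ) : ℕ :=
  (Finset.univ.filter fun p : Fin n × Fin n => M p.1 p.2 = 0).card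

/-- `𝒰(n, τ)`: the n×n (0,1)-matrices with exactly τ zero entries. -/
def Uclass (n τ : ℕ) : Set (Matrix (Fin n) (Fin n) ℕ) :=
  {M | IsZeroOne M ∧ zeroCount M = τ}

/-- `μ(n, τ) = max {per A : A ∈ 𝒰(n, τ)}`. -/
noncomputable def mu (n τ : ℕ) : ℕ :=
  sSup (perm '' Uclass n τ)

/-- `𝒜(n, k)`: the n×n (0,1)-matrices with exactly k ones in each row and column. -/
def Aclass (n k : ℕ) : Set (Matrix (Fin n) (Fin n) ℕ) :=
  {M | IsZeroOne M ∧ (∀ i, ∑ j, M i j = k) ∧ (∀ j, ∑ i, M i j = k)}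

/-- `P` is a permutation matrix. -/
def IsPermMatrix {n : ℕ} (P : Matrix (Fin n) (Fin n) ℕ) : Prop :=
  ∃ e : Equiv.Perm (Fin n), ∀ i j, P i j = if j = e i then 1 else 0

/-- `A` and `B` are combinatorially equivalent: `B = PAQ` or `B = PAᵀQ` for
permutation matrices `P`, `Q`. -/
def CombEquiv {n : ℕ} (A B : Matrix (Fin n) (Fin n) ℕ) : Prop :=
  ∃ P Q, IsPermMatrix P ∧ IsPermMatrix Q ∧ (B = P * A * Q ∨ B = P * A.transpose * Q)

/-- Index of the block (of consecutive sizes `L`) containing position `i`. -/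
def blockIdx : List ℕ → ℕ → ℕ
  | [], _ => 0
  | s :: L, i => if i < s then 0 else blockIdx L (i - s) + 1

/-- The n×n block-diagonal direct sum of all-ones blocks of sizes `L`
(with `L.sum = n`). -/
def listBlocks (n : ℕ) (L : List ℕ) : Matrix (Fin n) (Fin n) ℕ :=
  Matrix.of fun i j => if blockIdx L (i : ℕ) = blockIdx L (j : ℕ) then 1 else 0

/-- The n×n block-diagonal matrix with a head block `B` (of size `m`) followed by
all-ones blocks of sizes `L` (with `m + L.sum = n`). -/
def headBlocks (n : ℕ) {m : ℕ} (B : Matrix (Fin m) (Fin m) ℕ) (L : List ℕ) :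
    Matrix (Fin n) (Fin n) ℕ :=
  Matrix.of fun i j =>
    if h : (i : ℕ) < m ∧ (j : ℕ) < m then B ⟨(i : ℕ), h.1⟩ ⟨(j : ℕ), h.2⟩
    else if m ≤ (i : ℕ) ∧ m ≤ (j : ℕ) ∧
        blockIdx L ((i : ℕ) - m) = blockIdx L ((j : ℕ) - m) then 1 else 0

/-- `M` with the `(i0, j0)` entry changed to `1`. -/
def setOne {n : ℕ} (M : Matrix (Fin n) (Fin n) ℕ) (i0 j0 : Fin n) :
    Matrix (Fin n) (Fin n) ℕ :=
  Matrix.of fun i j => if i = i0 ∧ j = j0 then 1 else M i j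

/-- `J₃ - I₃`. -/
def J3mI3 : Matrix (Fin 3) (Fin 3) ℕ := Matrix.of fun i j => if i = j then 0 else 1

/-- `J₄ - I₄`. -/
def J4mI4 : Matrix (Fin 4) (Fin 4) ℕ := Matrix.of fun i j => if i = j then 0 else 1

/-- `A₃`: the 3×3 all-ones matrix except the (1,1) entry is 0. -/
def A3 : Matrix (Fin 3) (Fin 3) ℕ := Matrix.of fun i j => if i = 0 ∧ j = 0 then 0 else 1

/-- `A₃ ⊕ I₂`. -/
def V5 : Matrix (Fin 5) (Fin 5) ℕ :=
  !![0,1,1,0,0; 1,1,1,0,0; 1,1,1,0,0; 0,0,0,1,0; 0,0,0,0,1]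

/-- `J₃ ⊕ I₂`. -/
def S5 : Matrix (Fin 5) (Fin 5) ℕ :=
  !![1,1,1,0,0; 1,1,1,0,0; 1,1,1,0,0; 0,0,0,1,0; 0,0,0,0,1]

/-- The head block of `W`. -/
def BW : Matrix (Fin 4) (Fin 4) ℕ :=
  !![0,0,1,1; 1,1,0,1; 1,1,1,0; 1,1,0,1]

/-- The head block of `X`. -/
def BX : Matrix (Fin 4) (Fin 4) ℕ :=
  !![0,0,1,1; 1,0,1,1; 1,1,0,1; 1,1,1,0]

/-- The head block of `Y`. -/
def BY : Matrix (Fin 4) (Fin 4) ℕ :=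
  !![0,0,1,1; 1,0,1,1; 1,1,0,0; 1,1,1,1]

/-- `A₃ ⊕ I₁`. -/
def T4 : Matrix (Fin 4) (Fin 4) ℕ :=
  !![0,1,1,0; 1,1,1,0; 1,1,1,0; 0,0,0,1]

/-- `A₄ ⊕ J₂`, where `A₄` is `J₄` with the (1,1) entry changed to 0. -/
def Q6 : Matrix (Fin 6) (Fin 6) ℕ :=
  !![0,1,1,1,0,0; 1,1,1,1,0,0; 1,1,1,1,0,0; 1,1,1,1,0,0; 0,0,0,0,1,1; 0,0,0,0,1,1]

/-- `J₃ ⊕ I₁`. -/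
def M4 : Matrix (Fin 4) (Fin 4) ℕ :=
  !![1,1,1,0; 1,1,1,0; 1,1,1,0; 0,0,0,1]


section core
open scoped Classical
set_option linter.unusedSectionVars false
set_option linter.unusedSimpArgs false
set_option linter.unusedVariables false

variable {α β : Type} [DecidableEq α] [DecidableEq β]

/-- `M` is a perfect matching between `R` and `C` inside the relation `A`. -/
def IsPM (A : α → β → Prop) (R : Finset α) (C : Finset β) (M : Finset (α × β)) : Prop :=
  (∀ i j, (i, j) ∈ M → i ∈ R ∧ j ∈ C ∧ A i j) ∧ (∀ i ∈ R, ∃ j, (i, j) ∈ M) ∧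
  (∀ j ∈ C, ∃ i, (i, j) ∈ M) ∧ (∀ i j j', (i, j) ∈ M → (i, j') ∈ M → j = j') ∧
  (∀ i i' j, (i, j) ∈ M → (i', j) ∈ M → i = i')

/-- The set of perfect matchings. -/
noncomputable def PMs (A : α → β → Prop) (R : Finset α) (C : Finset β) : Finset (Finset (α × β)) :=
  (R ×ˢ C).powerset.filter (IsPM A R C)

/-- The number of perfect matchings, i.e. the permanent. -/
noncomputable def P (A : α → β → Prop) (R : Finset α) (C : Finset β) : ℕ :=
  (PMs A R C).card

/-- transpose -/
def tr (A : α → β → Prop) : β → α → Prop := fun j i => A i j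

/-- row degree -/
noncomputable def rd (A : α → β → Prop) (C : Finset β) (i : α) : ℕ := (C.filter (A i)).card

/-- column degree -/
noncomputable def cd (A : α → β → Prop) (R : Finset α) (j : β) : ℕ :=
  (R.filter (fun i => A i j)).card

/-- number of ones -/
noncomputable def sg (A : α → β → Prop) (R : Finset α) (C : Finset β) : ℕ := ∑ i ∈ R, rd A C i

/-- number of ones counted by columns -/
noncomputable def Nn (A : α → β → Prop) (R : Finset α) (C : Finset β) : ℤ :=
  5 * (R.card : ℤ) - sg A R C

theorem mem_PM {A : α → β → Prop} {R : Finset α} {C : Finset β} {M : Finset (α × β)} :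
    M ∈ PMs A R C ↔ IsPM A R C M := by
  rw [PMs, Finset.mem_filter, Finset.mem_powerset]
  constructor
  · exact fun h => h.2
  · refine fun h => ⟨?_, h⟩
    rintro ⟨i, j⟩ hp
    have := h.1 i j hp
    simp [this.1, this.2.1]

theorem P_tr (A : α → β → Prop) (R : Finset α) (C : Finset β) : P (tr A) C R = P A R C := by
  unfold P
  refine Finset.card_bij' (fun M _ => M.image Prod.swap) (fun M _ => M.image Prod.swap) ?_ ?_ ?_ ?_
  · intro M hM
    rw [mem_PM] at hM ⊢
    obtain ⟨h1, h2, h3, h4, h5⟩ := hM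
    simp only [IsPM, tr, Finset.mem_image, Prod.exists, Prod.swap_prod_mk, Prod.mk.injEq] at *
    grind
  · intro M hM
    rw [mem_PM] at hM ⊢
    obtain ⟨h1, h2, h3, h4, h5⟩ := hM
    simp only [IsPM, tr, Finset.mem_image, Prod.exists, Prod.swap_prod_mk, Prod.mk.injEq] at *
    grind
  · intro M _
    simp [Finset.image_image]
  · intro M _
    simp [Finset.image_image]

theorem P_empty (A : α → β → Prop) : P A ∅ ∅ = 1 := by
  unfold P
  rw [Finset.card_eq_one]
  refine ⟨∅, ?_⟩
  ext M
  rw [mem_PM]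
  simp only [Finset.mem_singleton]
  constructor
  · intro h
    rw [Finset.eq_empty_iff_forall_notMem]
    rintro ⟨i, j⟩ hp
    have := h.1 i j hp
    simp at this
  · rintro rfl
    simp [IsPM]

theorem P_mono {A B : α → β → Prop} {R : Finset α} {C : Finset β}
    (h : ∀ i ∈ R, ∀ j ∈ C, A i j → B i j) : P A R C ≤ P B R C := by
  unfold P
  apply Finset.card_le_card
  intro M hM
  rw [mem_PM] at hM ⊢
  obtain ⟨h1, h2⟩ := hM
  exact ⟨fun i j hp => ⟨(h1 i j hp).1, (h1 i j hp).2.1,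
    h _ (h1 i j hp).1 _ (h1 i j hp).2.1 (h1 i j hp).2.2⟩, h2⟩

theorem P_congr {A B : α → β → Prop} {R : Finset α} {C : Finset β}
    (h : ∀ i ∈ R, ∀ j ∈ C, (A i j ↔ B i j)) : P A R C = P B R C :=
  le_antisymm (P_mono fun i hi j hj => (h i hi j hj).1) (P_mono fun i hi j hj => (h i hi j hj).2)

theorem P_row (A : α → β → Prop) {R : Finset α} (C : Finset β) {i : α} (hi : i ∈ R) :
    P A R C = ∑ j ∈ C.filter (A i), P A (R.erase i) (C.erase j) := by
  have key : PMs A R C = (C.filter (A i)).biUnion fun j =>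
      (PMs A (R.erase i) (C.erase j)).image
        (insert (i, j)) := by
    ext M
    rw [mem_PM]
    simp only [Finset.mem_biUnion, Finset.mem_image, mem_PM, Finset.mem_filter]
    constructor
    · rintro ⟨h1, h2, h3, h4, h5⟩
      obtain ⟨j, hj⟩ := h2 i hi
      refine ⟨j, ⟨(h1 i j hj).2.1, (h1 i j hj).2.2⟩, M.erase (i, j), ?_, ?_⟩
      · refine ⟨?_, ?_, ?_, ?_, ?_⟩
        · intro a b hab
          simp only [Finset.mem_erase, ne_eq, Prod.mk.injEq] at hab ⊢
          have := h1 a b hab.2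
          have h6 := h4 i j b hj
          have h7 := h5 i a j hj
          grind
        · intro a ha
          simp only [Finset.mem_erase, ne_eq, Prod.mk.injEq] at ha ⊢
          obtain ⟨b, hb⟩ := h2 a ha.2
          exact ⟨b, by grind, hb⟩
        · intro b hb
          simp only [Finset.mem_erase, ne_eq, Prod.mk.injEq] at hb ⊢
          obtain ⟨a, ha⟩ := h3 b hb.2
          exact ⟨a, by grind, ha⟩
        · intro a b b' hb hb'
          exact h4 a b b' (Finset.mem_of_mem_erase hb) (Finset.mem_of_mem_erase hb')
        · intro a b b' hb hb'
          exact h5 a b b' (Finset.mem_of_mem_erase hb) (Finset.mem_of_mem_erase hb')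
      · exact Finset.insert_erase hj
    · rintro ⟨j, ⟨hj, hA⟩, M', ⟨h1, h2, h3, h4, h5⟩, rfl⟩
      refine ⟨?_, ?_, ?_, ?_, ?_⟩
      · intro a b hab
        rw [Finset.mem_insert] at hab
        rcases hab with hab | hab
        · simp only [Prod.mk.injEq] at hab
          obtain ⟨rfl, rfl⟩ := hab
          exact ⟨hi, hj, hA⟩
        · have := h1 a b hab
          simp only [Finset.mem_erase] at this
          tauto
      · intro a ha
        by_cases hai : a = i
        · exact ⟨j, by simp [hai]⟩
        · obtain ⟨b, hb⟩ := h2 a (by simp [hai, ha])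
          exact ⟨b, by simp [hb]⟩
      · intro b hb
        by_cases hbj : b = j
        · exact ⟨i, by simp [hbj]⟩
        · obtain ⟨a, ha⟩ := h3 b (by simp [hbj, hb])
          exact ⟨a, by simp [ha]⟩
      · intro a b b' hb hb'
        have e1 := h1 a b
        have e2 := h1 a b'
        have e3 := h4 a b b'
        simp only [Finset.mem_insert, Prod.mk.injEq, Finset.mem_erase] at *
        grind
      · intro a a' b hb hb'
        have e1 := h1 a b
        have e2 := h1 a' b
        have e3 := h5 a a' b
        simp only [Finset.mem_insert, Prod.mk.injEq, Finset.mem_erase] at *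
        grind
  unfold P
  rw [key, Finset.card_biUnion]
  · refine Finset.sum_congr rfl fun j _ => ?_
    apply Finset.card_image_of_injOn
    intro M hM M' hM' h
    rw [Finset.mem_coe, mem_PM] at hM hM'
    have n1 : (i, j) ∉ M := fun h => by simpa using (hM.1 i j h).1
    have n2 : (i, j) ∉ M' := fun h => by simpa using (hM'.1 i j h).1
    rw [← Finset.erase_insert n1, ← Finset.erase_insert n2]
    exact congrArg (fun s => Finset.erase s (i, j)) h
  · intro j _ j' _ hjj
    rw [Function.onFun, Finset.disjoint_left]
    intro M hM hM'
    simp only [Finset.mem_image, mem_PM] at hM hM'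
    obtain ⟨M1, h1, rfl⟩ := hM
    obtain ⟨M2, h2, h3⟩ := hM'
    have : (i, j') ∈ insert (i, j) M1 := by rw [← h3]; simp
    rw [Finset.mem_insert] at this
    rcases this with h | h
    · simp only [Prod.mk.injEq, true_and] at h
      exact hjj h.symm
    · simpa using (h1.1 i j' h).1

theorem P_col (A : α → β → Prop) (R : Finset α) {C : Finset β} {j : β} (hj : j ∈ C) :
    P A R C = ∑ i ∈ R.filter (fun i => A i j), P A (R.erase i) (C.erase j) := by
  rw [← P_tr, P_row (tr A) R hj]
  refine Finset.sum_congr rfl fun i _ => P_tr _ _ _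

theorem sg_tr (A : α → β → Prop) (R : Finset α) (C : Finset β) : sg (tr A) C R = sg A R C := by
  unfold sg rd tr
  simp only [Finset.card_filter]
  exact Finset.sum_comm

theorem sg_row (A : α → β → Prop) {R : Finset α} (C : Finset β) {i : α} (hi : i ∈ R) :
    sg A R C = rd A C i + sg A (R.erase i) C := by
  unfold sg
  exact (Finset.add_sum_erase _ _ hi).symm

theorem sg_col (A : α → β → Prop) (R : Finset α) {C : Finset β} {j : β} (hj : j ∈ C) :
    sg A R C = cd A R j + sg A R (C.erase j) := by
  rw [← sg_tr, sg_row (tr A) R hj, sg_tr]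
  rfl

theorem rd_erase (A : α → β → Prop) {C : Finset β} {i : α} {j : β} (hj : j ∈ C) (h : A i j) :
    rd A (C.erase j) i + 1 = rd A C i := by
  unfold rd
  rw [Finset.filter_erase, Finset.card_erase_add_one]
  simp [hj, h]

theorem cd_erase (A : α → β → Prop) {R : Finset α} {i : α} {j : β} (hi : i ∈ R) (h : A i j) :
    cd A (R.erase i) j + 1 = cd A R j := rd_erase (tr A) hi h

theorem rd_erase' (A : α → β → Prop) {C : Finset β} {i : α} {j : β} (h : ¬ A i j) :
    rd A (C.erase j) i = rd A C i := by
  unfold rd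
  rw [Finset.filter_erase, Finset.erase_eq_of_notMem]
  simp [h]

theorem cd_erase' (A : α → β → Prop) {R : Finset α} {i : α} {j : β} (h : ¬ A i j) :
    cd A (R.erase i) j = cd A R j := rd_erase' (tr A) h

theorem sg_minor (A : α → β → Prop) {R : Finset α} {C : Finset β} {i : α} {j : β} (hi : i ∈ R)
    (hj : j ∈ C) (h : A i j) :
    sg A (R.erase i) (C.erase j) + rd A C i + cd A R j = sg A R C + 1 := by
  have h1 := sg_row A C hi
  have h2 := sg_col A (R.erase i) hj
  have h3 := cd_erase A hi h
  omega

theorem Nn_minor (A : α → β → Prop) {R : Finset α} {C : Finset β} {i : α} {j : β} (hi : i ∈ R)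
    (hj : j ∈ C) (h : A i j) :
    Nn A (R.erase i) (C.erase j) = Nn A R C - 6 + rd A C i + cd A R j := by
  have h1 := sg_minor A hi hj h
  have h2 := Finset.card_erase_add_one hi
  unfold Nn
  omega

theorem Nn_tr (A : α → β → Prop) {R : Finset α} {C : Finset β} (h : R.card = C.card) :
    Nn (tr A) C R = Nn A R C := by
  unfold Nn
  rw [sg_tr, h]

/-- `A` with one more entry -/
def addOne (A : α → β → Prop) (i0 : α) (j0 : β) : α → β → Prop :=
  fun i j => A i j ∨ (i = i0 ∧ j = j0)

theorem P_addOne (A : α → β → Prop) {R : Finset α} {C : Finset β} {i0 : α} {j0 : β} (hi : i0 ∈ R)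
    (hj : j0 ∈ C) (h : ¬ A i0 j0) :
    P (addOne A i0 j0) R C =
      P A R C + P A (R.erase i0) (C.erase j0) := by
  rw [P_row _ C hi, P_row A C hi]
  have e : C.filter (addOne A i0 j0 i0) = insert j0 (C.filter (A i0)) := by
    ext j
    simp only [addOne, Finset.mem_filter, Finset.mem_insert]
    grind
  rw [e, Finset.sum_insert (by simp [h]), add_comm]
  congr 1
  · refine Finset.sum_congr rfl fun j _ => P_congr ?_
    intro a ha b _
    have : a ≠ i0 := Finset.ne_of_mem_erase ha
    simp [addOne, this]
  · refine P_congr ?_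
    intro a ha b _
    have : a ≠ i0 := Finset.ne_of_mem_erase ha
    simp [addOne, this]

theorem sg_addOne (A : α → β → Prop) {R : Finset α} {C : Finset β} {i0 : α} {j0 : β} (hi : i0 ∈ R)
    (hj : j0 ∈ C) (h : ¬ A i0 j0) :
    sg (addOne A i0 j0) R C = sg A R C + 1 := by
  rw [sg_row _ C hi, sg_row A C hi]
  have e : C.filter (addOne A i0 j0 i0) = insert j0 (C.filter (A i0)) := by
    ext j
    simp only [addOne, Finset.mem_filter, Finset.mem_insert]
    grind
  have e1 : rd (addOne A i0 j0) C i0 = rd A C i0 + 1 := by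
    unfold rd
    rw [e, Finset.card_insert_of_notMem (by simp [h])]
  have e2 : sg (addOne A i0 j0) (R.erase i0) C = sg A (R.erase i0) C := by
    unfold sg
    refine Finset.sum_congr rfl fun a ha => ?_
    have : a ≠ i0 := Finset.ne_of_mem_erase ha
    unfold rd
    congr 1
    ext b
    simp [addOne, this]
  omega

/-- Columns in `T` all have support exactly `S`. -/
def ColB (A : α → β → Prop) (R : Finset α) (C : Finset β) (S : Finset α) (T : Finset β) : Prop :=
  S ⊆ R ∧ T ⊆ C ∧ S.card = T.card ∧ ∀ i ∈ R, ∀ j ∈ T, (A i j ↔ i ∈ S)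

theorem P_colB (A : α → β → Prop) (k : ℕ) : ∀ (R : Finset α) (C : Finset β) (S : Finset α)
    (T : Finset β), T.card = k → ColB A R C S T →
    P A R C = k.factorial * P A (R \ S) (C \ T) := by
  induction k with
  | zero =>
    intro R C S T hk h
    have hT : T = ∅ := Finset.card_eq_zero.1 hk
    have hS : S = ∅ := Finset.card_eq_zero.1 (h.2.2.1.trans hk)
    simp [hT, hS]
  | succ k ih =>
    intro R C S T hk h
    obtain ⟨hS, hT, hc, hA⟩ := h
    obtain ⟨j, hj⟩ : T.Nonempty := by
      rw [← Finset.card_pos]; omega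
    rw [P_col A R (hT hj)]
    have e : R.filter (fun i => A i j) = S := by
      ext i
      simp only [Finset.mem_filter]
      have := hA i
      constructor
      · rintro ⟨h1, h2⟩
        exact (hA i h1 j hj).1 h2
      · intro h1
        exact ⟨hS h1, (hA i (hS h1) j hj).2 h1⟩
    rw [e]
    have : ∀ i ∈ S, P A (R.erase i) (C.erase j) = k.factorial * P A (R \ S) (C \ T) := by
      intro i hi
      rw [ih (R.erase i) (C.erase j) (S.erase i) (T.erase j)]
      · congr 2
        · ext x; simp only [Finset.mem_sdiff, Finset.mem_erase]; grind
        · ext x; simp only [Finset.mem_sdiff, Finset.mem_erase]; grind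
      · have := Finset.card_erase_add_one hj
        omega
      · refine ⟨Finset.erase_subset_erase _ hS, Finset.erase_subset_erase _ hT, ?_, ?_⟩
        · have := Finset.card_erase_add_one hj
          have := Finset.card_erase_add_one hi
          omega
        · intro a ha b hb
          simp only [Finset.mem_erase] at *
          rw [hA a ha.2 b hb.2]
          tauto
    rw [Finset.sum_congr rfl this, Finset.sum_const, hc, hk, Nat.factorial_succ]
    simp [mul_assoc]

theorem sg_colB {A : α → β → Prop} {R : Finset α} {C : Finset β} {S : Finset α}
    {T : Finset β} (h : ColB A R C S T) :
    sg A R C = T.card * T.card + sg A S (C \ T) + sg A (R \ S) (C \ T) := by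
  obtain ⟨hS, hT, hc, hA⟩ := h
  have h1 : ∀ i ∈ S, rd A C i = T.card + rd A (C \ T) i := by
    intro i hi
    unfold rd
    rw [← Finset.card_union_of_disjoint]
    · congr 1
      ext j
      have := hA i (hS hi) j
      have := @hT j
      simp only [Finset.mem_filter, Finset.mem_union, Finset.mem_sdiff]
      grind
    · rw [Finset.disjoint_left]
      intro j hj
      simp [hj]
  have h2 : ∀ i ∈ R \ S, rd A C i = rd A (C \ T) i := by
    intro i hi
    unfold rd
    congr 1
    ext j
    rw [Finset.mem_sdiff] at hi
    have := hA i hi.1 j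
    have := @hT j
    simp only [Finset.mem_filter, Finset.mem_sdiff]
    grind
  unfold sg
  rw [← Finset.sum_sdiff hS, Finset.sum_congr rfl h1, Finset.sum_congr rfl h2,
    Finset.sum_add_distrib]
  simp only [Finset.sum_const, smul_eq_mul, hc]
  ring

end core

section psi

/-- The normalised bound. -/
noncomputable def ψ (N : ℤ) : ℚ :=
  (2 / 9 : ℚ) ^ (N / 6) * (if N % 6 = 0 then 1 else if N % 6 = 1 then 2 / 3 else
    if N % 6 = 2 then 1 / 2 else if N % 6 = 3 then 1 / 3 else if N % 6 = 4 then 1 / 3 else 2 / 9)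

theorem psi_shift (p c : ℤ) : ψ (6 * p + c) = (2 / 9 : ℚ) ^ p * ψ c := by
  unfold ψ
  have h1 : (6 * p + c) / 6 = p + c / 6 := by omega
  have h2 : (6 * p + c) % 6 = c % 6 := by omega
  rw [h1, h2, zpow_add₀ (by norm_num), mul_assoc]

theorem psi_pos (N : ℤ) : 0 < ψ N := by
  unfold ψ
  have : (0 : ℚ) < (2 / 9 : ℚ) ^ (N / 6) := by positivity
  split_ifs <;> positivity

theorem psi_six (N : ℤ) : ψ (N - 6) = 9 / 2 * ψ N := by
  have h := psi_shift (-1) N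
  have h2 : N - 6 = 6 * (-1) + N := by ring
  rw [h2, h]
  norm_num

/-- values -/
theorem psi_vals : ψ 0 = 1 ∧ ψ 1 = 2 / 3 ∧ ψ 2 = 1 / 2 ∧ ψ 3 = 1 / 3 ∧ ψ 4 = 1 / 3 ∧ ψ 5 = 2 / 9 ∧
    ψ 6 = 2 / 9 ∧ ψ 7 = 4 / 27 ∧ ψ 8 = 1 / 9 ∧ ψ 9 = 2 / 27 ∧ ψ 10 = 2 / 27 ∧ ψ 11 = 4 / 81 ∧
    ψ 12 = 4 / 81 ∧ ψ 13 = 8 / 243 ∧ ψ (-1) = 1 ∧ ψ (-2) = 3 / 2 ∧ ψ (-3) = 3 / 2 ∧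
    ψ (-4) = 9 / 4 := by
  norm_num [ψ]

theorem psi_decomp (N : ℤ) : ∃ t : ℤ, ∃ x : ℚ, 0 < x ∧ 0 ≤ t ∧ t < 6 ∧ N % 6 = t ∧
    ∀ c, ψ (N + c) = x * ψ (t + c) := by
  refine ⟨N % 6, (2 / 9) ^ (N / 6), by positivity, by omega, by omega, rfl, fun c => ?_⟩
  rw [← psi_shift]
  congr 1
  omega

theorem psi_step (N : ℤ) : ψ (N + 1) ≤ ψ N ∧ ψ (N + 2) ≤ 2 / 3 * ψ N := by
  obtain ⟨t, x, hx, h0, h6, -, hc⟩ := psi_decomp N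
  have e0 := hc 0
  rw [add_zero] at e0
  rw [hc 1, hc 2, e0]
  obtain ⟨v0, v1, v2, v3, v4, v5, v6, v7, v8, v9, v10, v11, v12, v13, w⟩ := psi_vals
  interval_cases t <;> simp only [zero_add, add_zero, Int.reduceAdd, v0, v1, v2, v3, v4, v5, v6, v7,
    v8] <;> constructor <;> linarith

theorem psi_anti {M N : ℤ} (h : M ≤ N) : ψ N ≤ ψ M := by
  obtain ⟨k, rfl⟩ := Int.le.dest h
  clear h
  induction k with
  | zero => simp
  | succ k ih =>
    have := (psi_step (M + k)).1
    push_cast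
    rw [← add_assoc]
    linarith

/-- strict facts used in the analysis of equality. -/
theorem psi_facts (N : ℤ) :
    -- one more entry
    (ψ (N + 1) = ψ N → N % 6 = 3 ∨ N % 6 = 5) ∧ ψ (N + 2) < ψ N ∧
    -- a row with one entry
    (ψ (N - 4) ≤ 3 * ψ N) ∧ (ψ (N - 4) = 3 * ψ N → N % 6 ≠ 0 ∧ N % 6 ≠ 1) ∧
    (ψ (N - 3) ≤ 3 * ψ N) ∧ (ψ (N - 3) = 3 * ψ N → N % 6 = 3) ∧
    -- a row with two entries
    (2 * ψ (N - 1) ≤ 3 * ψ N) ∧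
    (2 * ψ (N - 1) = 3 * ψ N → N % 6 ≠ 0 ∧ N % 6 ≠ 4) ∧
    (ψ (N - 1) + ψ N < 3 * ψ N) ∧
    (3 * ψ (N - 2) + ψ (N - 4) ≤ 9 * ψ N) ∧
    (3 * ψ (N - 2) + ψ (N - 4) = 9 * ψ N → N % 6 = 2 ∨ N % 6 = 3) ∧
    -- four entries
    (4 * ψ (N + 2) < 3 * ψ N) := by
  obtain ⟨t, x, hx, h0, h6, ht, hc⟩ := psi_decomp N
  have e0 := hc 0
  rw [add_zero] at e0
  have m1 := hc (-1)
  have m2 := hc (-2)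
  have m3 := hc (-3)
  have m4 := hc (-4)
  simp only [← sub_eq_add_neg] at m1 m2 m3 m4
  rw [hc 1, hc 2, e0, m1, m2, m3, m4, ht]
  obtain ⟨v0, v1, v2, v3, v4, v5, v6, v7, v8, v9, v10, v11, v12, v13, w1, w2, w3, w4⟩ := psi_vals
  interval_cases t <;> simp only [zero_add, add_zero, Int.reduceAdd, Int.reduceSub, Int.reduceNeg,
      zero_sub, v0, v1, v2, v3, v4, v5, v6, v7, v8, w1, w2, w3, w4] <;>
    refine ⟨fun h => ?_, ?_, ?_, fun h => ?_, ?_, fun h => ?_, ?_, fun h => ?_, ?_, ?_,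
      fun h => ?_, ?_⟩ <;> first | linarith | decide | (exfalso; linarith)

theorem psi_big (N : ℤ) (r : ℕ) (hr : 4 ≤ r) : r * ψ (N - 6 + 2 * r) < 3 * ψ N := by
  induction r, hr using Nat.le_induction with
  | base =>
    have := (psi_facts N).2.2.2.2.2.2.2.2.2.2.2
    norm_num
    convert this using 3
    ring
  | succ r hr ih =>
    have h1 := (psi_step (N - 6 + 2 * r)).2
    have h2 : N - 6 + 2 * ((r + 1 : ℕ) : ℤ) = N - 6 + 2 * r + 2 := by push_cast; ring
    rw [h2]
    have h3 := psi_pos (N - 6 + 2 * r)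
    have h4 : (4 : ℚ) ≤ r := by exact_mod_cast hr
    push_cast
    nlinarith

end psi

section shapes
open scoped Classical
set_option linter.unusedSectionVars false
set_option linter.unusedSimpArgs false
set_option linter.unusedVariables false

variable {α β : Type} [DecidableEq α] [DecidableEq β]

/-- `S × T` is an all-ones direct summand. -/
def Block (A : α → β → Prop) (R : Finset α) (C : Finset β) (S : Finset α) (T : Finset β) : Prop :=
  S ⊆ R ∧ T ⊆ C ∧ S.card = T.card ∧ (T.card = 2 ∨ T.card = 3) ∧
  ∀ i ∈ R, ∀ j ∈ C, (i ∈ S ∨ j ∈ T) → (A i j ↔ (i ∈ S ∧ j ∈ T))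

/-- direct sum of `J_2`, `J_3` -/
def JS (A : α → β → Prop) (R : Finset α) (C : Finset β) : Prop :=
  (∀ i ∈ R, ∃ S T, Block A R C S T ∧ i ∈ S) ∧ (∀ j ∈ C, ∃ S T, Block A R C S T ∧ j ∈ T)

/-- `S × T` is a direct summand -/
def Split (A : α → β → Prop) (R : Finset α) (C : Finset β) (S : Finset α) (T : Finset β) : Prop :=
  S ⊆ R ∧ T ⊆ C ∧ ∀ i ∈ R, ∀ j ∈ C, A i j → (i ∈ S ↔ j ∈ T)

/-- all ones but one -/
def HB (A : α → β → Prop) (k : ℕ) (S : Finset α) (T : Finset β) : Prop :=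
  S.card = k ∧ T.card = k ∧ ∃ i0 ∈ S, ∃ j0 ∈ T, ∀ i ∈ S, ∀ j ∈ T, (A i j ↔ ¬ (i = i0 ∧ j = j0))

/-- 1×1 summand -/
def Iso1 (A : α → β → Prop) (R : Finset α) (C : Finset β) (i : α) (j : β) : Prop :=
  i ∈ R ∧ j ∈ C ∧ ∀ i' ∈ R, ∀ j' ∈ C, (i' = i ∨ j' = j) → (A i' j' ↔ (i' = i ∧ j' = j))

/-- remove an entry -/
def delOne (A : α → β → Prop) (i0 : α) (j0 : β) : α → β → Prop :=
  fun i j => A i j ∧ ¬ (i = i0 ∧ j = j0)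

/-- holed block plus `J`s -/
def EH (k : ℕ) (A : α → β → Prop) (R : Finset α) (C : Finset β) : Prop :=
  ∃ S T, Split A R C S T ∧ HB A k S T ∧ JS A (R \ S) (C \ T)

/-- extremal of class 4 -/
def E4 (A : α → β → Prop) (R : Finset α) (C : Finset β) : Prop :=
  ∃ i j, Iso1 A R C i j ∧ JS A (R.erase i) (C.erase j)

/-- extremal, T type -/
def ET (A : α → β → Prop) (R : Finset α) (C : Finset β) : Prop :=
  ∃ i j, Iso1 A R C i j ∧ EH 3 A (R.erase i) (C.erase j)

/-- extremal, P* type -/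
def EP (A : α → β → Prop) (R : Finset α) (C : Finset β) : Prop :=
  ∃ i0 ∈ R, ∃ j0 ∈ C, A i0 j0 ∧ JS (delOne A i0 j0) R C

/-- extremal matrices by class -/
def Ext (q : ℤ) (A : α → β → Prop) (R : Finset α) (C : Finset β) : Prop :=
  (q = 0 → JS A R C) ∧ (q = 1 → EH 3 A R C) ∧ (q = 4 → E4 A R C) ∧
  (q = 5 → (ET A R C ∨ EH 4 A R C ∨ EP A R C))

theorem Block_tr {A : α → β → Prop} {R : Finset α} {C : Finset β} {S : Finset α} {T : Finset β}
    (h : Block A R C S T) : Block (tr A) C R T S := by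
  obtain ⟨h1, h2, h3, h4, h5⟩ := h
  exact ⟨h2, h1, h3.symm, by rw [h3]; exact h4, fun j hj i hi hh => by
    have := h5 i hi j hj hh.symm
    rw [tr, this, and_comm]⟩

theorem JS_tr {A : α → β → Prop} {R : Finset α} {C : Finset β} (h : JS A R C) :
    JS (tr A) C R := by
  refine ⟨fun j hj => ?_, fun i hi => ?_⟩
  · obtain ⟨S, T, hb, hm⟩ := h.2 j hj
    exact ⟨T, S, Block_tr hb, hm⟩
  · obtain ⟨S, T, hb, hm⟩ := h.1 i hi
    exact ⟨T, S, Block_tr hb, hm⟩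

theorem Iso1_tr {A : α → β → Prop} {R : Finset α} {C : Finset β} {i : α} {j : β}
    (h : Iso1 A R C i j) : Iso1 (tr A) C R j i := by
  obtain ⟨h1, h2, h3⟩ := h
  refine ⟨h2, h1, fun j' hj' i' hi' hh => ?_⟩
  have := h3 i' hi' j' hj' hh.symm
  rw [tr, this, and_comm]

theorem EH_tr {k : ℕ} {A : α → β → Prop} {R : Finset α} {C : Finset β} (h : EH k A R C) :
    EH k (tr A) C R := by
  obtain ⟨S, T, ⟨h1, h2, h3⟩, ⟨h4, h5, i0, hi0, j0, hj0, h6⟩, h7⟩ := h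
  refine ⟨T, S, ⟨h2, h1, fun j hj i hi hh => (h3 i hi j hj hh).symm⟩,
    ⟨h5, h4, j0, hj0, i0, hi0, fun j hj i hi => ?_⟩, JS_tr h7⟩
  have := h6 i hi j hj
  rw [tr, this, and_comm]

theorem Ext_tr {q : ℤ} {A : α → β → Prop} {R : Finset α} {C : Finset β} (h : Ext q A R C) :
    Ext q (tr A) C R := by
  obtain ⟨h0, h1, h4, h5⟩ := h
  refine ⟨fun hq => JS_tr (h0 hq), fun hq => EH_tr (h1 hq), fun hq => ?_, fun hq => ?_⟩
  · obtain ⟨i, j, hi, hj⟩ := h4 hq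
    exact ⟨j, i, Iso1_tr hi, JS_tr hj⟩
  · rcases h5 hq with h | h | h
    · obtain ⟨i, j, hi, hj⟩ := h
      exact Or.inl ⟨j, i, Iso1_tr hi, EH_tr hj⟩
    · exact Or.inr (Or.inl (EH_tr h))
    · obtain ⟨i0, hi0, j0, hj0, ha, hj⟩ := h
      refine Or.inr (Or.inr ⟨j0, hj0, i0, hi0, ha, ?_⟩)
      have : delOne (tr A) j0 i0 = tr (delOne A i0 j0) := by
        funext j i
        simp only [delOne, tr, and_comm]
      rw [this]
      exact JS_tr hj

theorem Block_congr {A B : α → β → Prop} {R : Finset α} {C : Finset β} {S : Finset α} {T : Finset β}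
    (hAB : ∀ i ∈ R, ∀ j ∈ C, (A i j ↔ B i j)) (h : Block A R C S T) : Block B R C S T := by
  obtain ⟨h1, h2, h3, h4, h5⟩ := h
  exact ⟨h1, h2, h3, h4, fun i hi j hj hh => (hAB i hi j hj).symm.trans (h5 i hi j hj hh)⟩

theorem JS_congr {A B : α → β → Prop} {R : Finset α} {C : Finset β}
    (hAB : ∀ i ∈ R, ∀ j ∈ C, (A i j ↔ B i j)) (h : JS A R C) : JS B R C := by
  refine ⟨fun j hj => ?_, fun i hi => ?_⟩
  · obtain ⟨S, T, hb, hm⟩ := h.1 j hj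
    exact ⟨S, T, Block_congr hAB hb, hm⟩
  · obtain ⟨S, T, hb, hm⟩ := h.2 i hi
    exact ⟨S, T, Block_congr hAB hb, hm⟩

theorem JS_empty (A : α → β → Prop) : JS A ∅ ∅ := by
  constructor <;> simp

/-- blocks of the complement are blocks -/
theorem Block_lift {A : α → β → Prop} {R : Finset α} {C : Finset β} {S : Finset α} {T : Finset β}
    {S' : Finset α} {T' : Finset β} (hs : Split A R C S T)
    (h : Block A (R \ S) (C \ T) S' T') : Block A R C S' T' := by
  obtain ⟨s1, s2, s3⟩ := hs
  obtain ⟨h1, h2, h3, h4, h5⟩ := h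
  refine ⟨h1.trans Finset.sdiff_subset, h2.trans Finset.sdiff_subset, h3, h4, ?_⟩
  intro i hi j hj hh
  have a1 := @h1 i
  have a2 := @h2 j
  have a3 := h5 i
  have a4 := s3 i hi j hj
  simp only [Finset.mem_sdiff] at *
  grind

theorem Block_split {A : α → β → Prop} {R : Finset α} {C : Finset β} {S : Finset α} {T : Finset β}
    (h : Block A R C S T) : Split A R C S T := by
  obtain ⟨h1, h2, h3, h4, h5⟩ := h
  refine ⟨h1, h2, fun i hi j hj ha => ?_⟩
  have := h5 i hi j hj
  tauto

theorem JS_add {A : α → β → Prop} {R : Finset α} {C : Finset β} {S : Finset α} {T : Finset β}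
    (hb : Block A R C S T) (h : JS A (R \ S) (C \ T)) : JS A R C := by
  refine ⟨fun j hj => ?_, fun i hi => ?_⟩
  · by_cases hh : j ∈ S
    · exact ⟨S, T, hb, hh⟩
    · obtain ⟨S', T', hb', hm⟩ := h.1 j (by simp [hj, hh])
      exact ⟨S', T', Block_lift (Block_split hb) hb', hm⟩
  · by_cases hh : i ∈ T
    · exact ⟨S, T, hb, hh⟩
    · obtain ⟨S', T', hb', hm⟩ := h.2 i (by simp [hi, hh])
      exact ⟨S', T', Block_lift (Block_split hb) hb', hm⟩

theorem Block_disj {A : α → β → Prop} {R : Finset α} {C : Finset β} {S : Finset α} {T : Finset β}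
    {S' : Finset α} {T' : Finset β} (h : Block A R C S T) (h' : Block A R C S' T') :
    (S = S' ∧ T = T') ∨ (Disjoint S S' ∧ Disjoint T T') := by
  obtain ⟨h1, h2, h3, h4, h5⟩ := h
  obtain ⟨h1', h2', h3', h4', h5'⟩ := h'
  obtain ⟨x, hx⟩ : T.Nonempty := by rw [← Finset.card_pos]; omega
  obtain ⟨x', hx'⟩ : T'.Nonempty := by rw [← Finset.card_pos]; omega
  obtain ⟨y, hy⟩ : S.Nonempty := by rw [← Finset.card_pos]; omega
  obtain ⟨y', hy'⟩ : S'.Nonempty := by rw [← Finset.card_pos]; omega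
  by_cases hd : Disjoint S S'
  · right
    refine ⟨hd, ?_⟩
    rw [Finset.disjoint_left] at hd ⊢
    intro z hz hz'
    have := h5 y (h1 hy) z (h2 hz)
    have := h5' y (h1 hy) z (h2 hz)
    have := hd hy
    tauto
  · left
    rw [Finset.not_disjoint_iff] at hd
    obtain ⟨z, hz, hz'⟩ := hd
    have eT : T = T' := by
      ext w
      constructor
      · intro hw
        have := h5 z (h1 hz) w (h2 hw)
        have := h5' z (h1 hz) w (h2 hw)
        tauto
      · intro hw
        have := h5 z (h1 hz) w (h2' hw)
        have := h5' z (h1 hz) w (h2' hw)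
        tauto
    subst eT
    refine ⟨?_, rfl⟩
    ext w
    constructor
    · intro hw
      have := h5 w (h1 hw) x (h2 hx)
      have := h5' w (h1 hw) x (h2 hx)
      tauto
    · intro hw
      have := h5 w (h1' hw) x (h2 hx)
      have := h5' w (h1' hw) x (h2 hx)
      tauto

theorem Block_restr {A : α → β → Prop} {R : Finset α} {C : Finset β} {S : Finset α} {T : Finset β}
    {S' : Finset α} {T' : Finset β} (h : Block A R C S T) (h1 : Disjoint S S')
    (h2 : Disjoint T T') : Block A (R \ S') (C \ T') S T := by
  obtain ⟨a1, a2, a3, a4, a5⟩ := h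
  refine ⟨?_, ?_, a3, a4, ?_⟩
  · exact Finset.subset_sdiff.2 ⟨a1, h1⟩
  · exact Finset.subset_sdiff.2 ⟨a2, h2⟩
  · intro i hi j hj
    exact a5 i (Finset.mem_sdiff.1 hi).1 j (Finset.mem_sdiff.1 hj).1

theorem JS_rem {A : α → β → Prop} {R : Finset α} {C : Finset β} {S : Finset α} {T : Finset β}
    (hb : Block A R C S T) (h : JS A R C) : JS A (R \ S) (C \ T) := by
  refine ⟨fun j hj => ?_, fun i hi => ?_⟩
  · rw [Finset.mem_sdiff] at hj
    obtain ⟨S', T', hb', hm⟩ := h.1 j hj.1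
    rcases Block_disj hb' hb with ⟨rfl, rfl⟩ | ⟨hd1, hd2⟩
    · exact absurd hm hj.2
    · exact ⟨S', T', Block_restr hb' hd1 hd2, hm⟩
  · rw [Finset.mem_sdiff] at hi
    obtain ⟨S', T', hb', hm⟩ := h.2 i hi.1
    rcases Block_disj hb' hb with ⟨rfl, rfl⟩ | ⟨hd1, hd2⟩
    · exact absurd hm hi.2
    · exact ⟨S', T', Block_restr hb' hd1 hd2, hm⟩

theorem EH_add {k : ℕ} {A : α → β → Prop} {R : Finset α} {C : Finset β} {S : Finset α}
    {T : Finset β} (hb : Block A R C S T) (h : EH k A (R \ S) (C \ T)) : EH k A R C := by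
  obtain ⟨S', T', ⟨h1, h2, h3⟩, hh, hj⟩ := h
  have d1 : Disjoint S S' := (Finset.subset_sdiff.1 h1).2.symm
  have d2 : Disjoint T T' := (Finset.subset_sdiff.1 h2).2.symm
  refine ⟨S', T', ⟨h1.trans Finset.sdiff_subset, h2.trans Finset.sdiff_subset, ?_⟩, hh, ?_⟩
  · intro i hi j hj ha
    have a1 := (Block_split hb).2.2 i hi j hj ha
    have a2 := h3 i
    have a3 := @h1 i
    have a4 := @h2 j
    simp only [Finset.mem_sdiff] at *
    grind
  · refine JS_add (Block_restr hb d1 d2) ?_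
    rw [show (R \ S') \ S = (R \ S) \ S' from sdiff_right_comm .., show (C \ T') \ T = (C \ T) \ T' from sdiff_right_comm ..]
    exact hj

theorem Iso1_add {A : α → β → Prop} {R : Finset α} {C : Finset β} {S : Finset α}
    {T : Finset β} {i : α} {j : β} (hb : Block A R C S T) (h : Iso1 A (R \ S) (C \ T) i j) :
    Iso1 A R C i j ∧ Block A (R.erase i) (C.erase j) S T ∧
      R.erase i \ S = (R \ S).erase i ∧ C.erase j \ T = (C \ T).erase j := by
  obtain ⟨h1, h2, h3⟩ := h
  rw [Finset.mem_sdiff] at h1 h2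
  refine ⟨⟨h1.1, h2.1, ?_⟩, ?_, ?_, ?_⟩
  · intro i' hi' j' hj' hh
    have a1 := (Block_split hb).2.2 i' hi' j' hj'
    have a2 := h3 i'
    simp only [Finset.mem_sdiff] at *
    grind
  · rw [← Finset.sdiff_singleton_eq_erase, ← Finset.sdiff_singleton_eq_erase]
    apply Block_restr hb <;> simp [h1, h2]
  · ext; simp only [Finset.mem_sdiff, Finset.mem_erase]; tauto
  · ext; simp only [Finset.mem_sdiff, Finset.mem_erase]; tauto

theorem Ext_add {q : ℤ} {A : α → β → Prop} {R : Finset α} {C : Finset β} {S : Finset α}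
    {T : Finset β} (hb : Block A R C S T) (h : Ext q A (R \ S) (C \ T)) : Ext q A R C := by
  obtain ⟨h0, h1, h4, h5⟩ := h
  refine ⟨fun hq => JS_add hb (h0 hq), fun hq => EH_add hb (h1 hq), fun hq => ?_, fun hq => ?_⟩
  · obtain ⟨i, j, hi, hj⟩ := h4 hq
    obtain ⟨k1, k2, k3, k4⟩ := Iso1_add hb hi
    exact ⟨i, j, k1, JS_add k2 (by rw [k3, k4]; exact hj)⟩
  · rcases h5 hq with h | h | h
    · obtain ⟨i, j, hi, hj⟩ := h
      obtain ⟨k1, k2, k3, k4⟩ := Iso1_add hb hi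
      exact Or.inl ⟨i, j, k1, EH_add k2 (by rw [k3, k4]; exact hj)⟩
    · exact Or.inr (Or.inl (EH_add hb h))
    · obtain ⟨i0, hi0, j0, hj0, ha, hj⟩ := h
      rw [Finset.mem_sdiff] at hi0 hj0
      refine Or.inr (Or.inr ⟨i0, hi0.1, j0, hj0.1, ha, ?_⟩)
      refine JS_add ?_ hj
      · obtain ⟨b1, b2, b3, b4, b5⟩ := hb
        refine ⟨b1, b2, b3, b4, ?_⟩
        intro i hi j hj hh
        have := b5 i hi j hj hh
        simp only [delOne]
        grind

/-- degrees inside a block -/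
theorem Block_cd {A : α → β → Prop} {R : Finset α} {C : Finset β} {S : Finset α} {T : Finset β}
    (h : Block A R C S T) {j : β} (hj : j ∈ T) : cd A R j = T.card := by
  obtain ⟨h1, h2, h3, h4, h5⟩ := h
  rw [← h3, cd]
  congr 1
  ext i
  have := @h1 i
  have := h5 i
  have := @h2 j
  rw [Finset.mem_filter]
  grind

theorem Block_rd {A : α → β → Prop} {R : Finset α} {C : Finset β} {S : Finset α} {T : Finset β}
    (h : Block A R C S T) {i : α} (hi : i ∈ S) : rd A C i = T.card := by
  have := Block_cd (Block_tr h) hi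
  rw [← h.2.2.1]
  exact this

end shapes

section good
open scoped Classical
set_option linter.unusedSectionVars false
set_option linter.unusedSimpArgs false
set_option linter.unusedVariables false

variable {α β : Type} [DecidableEq α] [DecidableEq β]

/-- The inductive claim. -/
def Good (A : α → β → Prop) (R : Finset α) (C : Finset β) : Prop :=
  (P A R C : ℚ) ≤ 3 ^ R.card * ψ (Nn A R C) ∧
  ((P A R C : ℚ) = 3 ^ R.card * ψ (Nn A R C) → Ext (Nn A R C % 6) A R C)

theorem tr_tr (A : α → β → Prop) : tr (tr A) = A := rfl

theorem Good_tr {A : α → β → Prop} {R : Finset α} {C : Finset β} (hc : R.card = C.card)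
    (h : Good (tr A) C R) : Good A R C := by
  unfold Good at h
  rw [P_tr, Nn_tr A hc, ← hc] at h
  exact ⟨h.1, fun e => Ext_tr (h.2 e)⟩

theorem Good_of_lt {A : α → β → Prop} {R : Finset α} {C : Finset β}
    (h : (P A R C : ℚ) < 3 ^ R.card * ψ (Nn A R C)) : Good A R C :=
  ⟨h.le, fun e => absurd e h.ne⟩

theorem sg_zero {A : α → β → Prop} {R : Finset α} {C : Finset β} :
    sg A R C = 0 ↔ ∀ i ∈ R, ∀ j ∈ C, ¬ A i j := by
  unfold sg rd
  rw [Finset.sum_eq_zero_iff]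
  simp only [Finset.card_eq_zero, Finset.filter_eq_empty_iff]

theorem addOne_delOne {A : α → β → Prop} {i0 : α} {j0 : β} (h : A i0 j0) :
    addOne (delOne A i0 j0) i0 j0 = A := by
  funext i j
  simp only [addOne, delOne, eq_iff_iff]
  by_cases hh : i = i0 ∧ j = j0
  · obtain ⟨rfl, rfl⟩ := hh
    simp [h]
  · tauto

theorem sg_delOne {A : α → β → Prop} {R : Finset α} {C : Finset β} {i0 : α} {j0 : β} (hi : i0 ∈ R)
    (hj : j0 ∈ C) (h : A i0 j0) : sg A R C = sg (delOne A i0 j0) R C + 1 := by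
  have := sg_addOne (delOne A i0 j0) hi hj (by simp [delOne])
  rwa [addOne_delOne h] at this

theorem Ext_trivial {q : ℤ} {A : α → β → Prop} {R : Finset α} {C : Finset β}
    (h : q = 2 ∨ q = 3) : Ext q A R C := by
  refine ⟨?_, ?_, ?_, ?_⟩ <;> intro hq <;> omega

theorem reduceCol {A : α → β → Prop} {R : Finset α} {C : Finset β} {S : Finset α} {T : Finset β}
    (hb : ColB A R C S T) (hT : T.card = 2 ∨ T.card = 3)
    (hG : Good A (R \ S) (C \ T)) : Good A R C := by
  have hsg := sg_colB hb
  have hP := P_colB A T.card R C S T rfl hb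
  obtain ⟨h1, h2, h3, h4⟩ := hb
  have hcard := Finset.card_sdiff_add_card_eq_card h1
  obtain ⟨t, ht⟩ : ∃ t, t = sg A S (C \ T) := ⟨_, rfl⟩
  rw [← ht] at hsg
  have hN : Nn A (R \ S) (C \ T) = Nn A R C - 6 + t := by
    unfold Nn
    rw [hsg, ← hcard, h3]
    push_cast
    rcases hT with h | h <;> rw [h] <;> push_cast <;> ring
  obtain ⟨g1, g2⟩ := hG
  rw [hN] at g1 g2
  have e6 : ψ (Nn A R C - 6 + t) = 9 / 2 * ψ (Nn A R C + t) := by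
    rw [← psi_six]; congr 1; ring
  rw [e6] at g1 g2
  have hfac : ((T.card.factorial : ℕ) : ℚ) * (3 ^ (R \ S).card * (9 / 2 * ψ (Nn A R C + t)))
      = 3 ^ R.card * ψ (Nn A R C + t) := by
    rw [← hcard, h3, pow_add]
    rcases hT with h | h <;> rw [h] <;> norm_num [Nat.factorial] <;> ring
  have hPq : (P A R C : ℚ) = (T.card.factorial : ℕ) * (P A (R \ S) (C \ T) : ℚ) := by
    rw [hP]; push_cast; ring
  have hfp : (0 : ℚ) < (T.card.factorial : ℕ) := by exact_mod_cast Nat.factorial_pos _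
  have hle : (P A R C : ℚ) ≤ 3 ^ R.card * ψ (Nn A R C + t) := by
    rw [hPq, ← hfac]
    exact mul_le_mul_of_nonneg_left g1 hfp.le
  have hanti : ψ (Nn A R C + t) ≤ ψ (Nn A R C) := psi_anti (by omega)
  have h3p : (0 : ℚ) < 3 ^ R.card := by positivity
  refine ⟨hle.trans (mul_le_mul_of_nonneg_left hanti h3p.le), fun heq => ?_⟩
  have hpe : ψ (Nn A R C + t) = ψ (Nn A R C) := by
    apply le_antisymm hanti
    rw [heq] at hle
    exact le_of_mul_le_mul_left hle h3p
  have hPe : (P A (R \ S) (C \ T) : ℚ) = 3 ^ (R \ S).card * (9 / 2 * ψ (Nn A R C + t)) := by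
    apply mul_left_cancel₀ hfp.ne'
    rw [← hPq, hfac, heq, hpe]
  have hE := g2 hPe
  obtain ⟨f1, f2, -⟩ := psi_facts (Nn A R C)
  rcases Nat.lt_or_ge t 2 with h | h
  · interval_cases t
    · have hz := sg_zero.1 ht.symm
      have hB : Block A R C S T := by
        refine ⟨h1, h2, h3, hT, ?_⟩
        intro i hi j hj hh
        have := h4 i hi j
        have := hz i
        simp only [Finset.mem_sdiff] at *
        grind
      apply Ext_add hB
      convert hE using 1
      push_cast
      omega
    · have f1' := f1 (by exact_mod_cast hpe)
      rcases f1' with h3' | h5'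
      · exact Ext_trivial (Or.inr h3')
      · have hJ := hE.1 (by push_cast; omega)
        have hex : ∃ i ∈ S, ∃ j ∈ C \ T, A i j := by
          by_contra hcon
          push Not at hcon
          have := sg_zero.2 hcon
          omega
        obtain ⟨i0, hi0, j0, hj0, ha⟩ := hex
        have hd := sg_delOne hi0 hj0 ha
        have hz := sg_zero.1 (show sg (delOne A i0 j0) S (C \ T) = 0 by omega)
        rw [Finset.mem_sdiff] at hj0
        have hB : Block (delOne A i0 j0) R C S T := by
          refine ⟨h1, h2, h3, hT, ?_⟩
          intro i hi j hj hh
          have := h4 i hi j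
          have := hz i
          simp only [Finset.mem_sdiff, delOne] at *
          grind
        refine ⟨fun _ => by omega, fun _ => by omega, fun _ => by omega, fun _ => Or.inr (Or.inr ?_)⟩
        refine ⟨i0, h1 hi0, j0, hj0.1, ha, JS_add hB (JS_congr ?_ hJ)⟩
        intro i hi j hj
        simp only [Finset.mem_sdiff, delOne] at *
        grind
  · exfalso
    have : ψ (Nn A R C + t) ≤ ψ (Nn A R C + 2) := psi_anti (by omega)
    linarith

theorem reduceRow {A : α → β → Prop} {R : Finset α} {C : Finset β} {S : Finset α} {T : Finset β}
    (hRC : R.card = C.card)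
    (hb : ColB (tr A) C R T S) (hT : T.card = 2 ∨ T.card = 3)
    (hG : Good A (R \ S) (C \ T)) : Good A R C := by
  have hc := hb.2.2.1
  apply Good_tr hRC
  apply reduceCol hb (by omega)
  apply Good_tr ?_ hG
  have := Finset.card_sdiff_add_card_eq_card hb.1
  have := Finset.card_sdiff_add_card_eq_card hb.2.1
  omega

end good

section step
open scoped Classical
set_option linter.unusedSectionVars false
set_option linter.unusedSimpArgs false
set_option linter.unusedVariables false

variable {α β : Type} [DecidableEq α] [DecidableEq β]

/-- normalised permanent -/
noncomputable def Qn (A : α → β → Prop) (R : Finset α) (C : Finset β) : ℚ :=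
  (P A R C : ℚ) / 3 ^ R.card

theorem good_iff {A : α → β → Prop} {R : Finset α} {C : Finset β} :
    Good A R C ↔ (Qn A R C ≤ ψ (Nn A R C) ∧
      (Qn A R C = ψ (Nn A R C) → Ext (Nn A R C % 6) A R C)) := by
  have h : (0 : ℚ) < 3 ^ R.card := by positivity
  unfold Good Qn
  rw [div_le_iff₀ h, div_eq_iff h.ne', mul_comm (ψ _)]

theorem Qn_nonneg (A : α → β → Prop) (R : Finset α) (C : Finset β) : 0 ≤ Qn A R C := by
  unfold Qn; positivity

theorem Qn_row (A : α → β → Prop) {R : Finset α} (C : Finset β) {i : α} (hi : i ∈ R) :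
    3 * Qn A R C = ∑ j ∈ C.filter (A i), Qn A (R.erase i) (C.erase j) := by
  unfold Qn
  rw [P_row A C hi, ← Finset.sum_div, ← Finset.card_erase_add_one hi, pow_succ]
  push_cast
  field_simp

/-- induction hypothesis -/
def IHp (α β : Type) [DecidableEq α] [DecidableEq β] (n : ℕ) : Prop :=
  ∀ (B : α → β → Prop) (R : Finset α) (C : Finset β), R.card = C.card → R.card < n → Good B R C

theorem IHp_tr {n : ℕ} (h : IHp α β n) : IHp β α n := fun B R C hc hn =>
  Good_tr hc (h (tr B) C R hc.symm (by omega))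

theorem IH_minor {A : α → β → Prop} {R : Finset α} {C : Finset β} (hRC : R.card = C.card)
    (ih : IHp α β R.card) {i : α} {j : β} (hi : i ∈ R) (hj : j ∈ C) (B : α → β → Prop) :
    Good B (R.erase i) (C.erase j) := by
  have h1 := Finset.card_erase_add_one hi
  have h2 := Finset.card_erase_add_one hj
  exact ih _ _ _ (by omega) (by omega)

theorem Q_minor {A : α → β → Prop} {R : Finset α} {C : Finset β} (hRC : R.card = C.card)
    (ih : IHp α β R.card) {i : α} {j : β} (hi : i ∈ R) (hj : j ∈ C) (h : A i j) {r c : ℕ}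
    (hr : rd A C i = r) (hc : cd A R j = c) :
    Qn A (R.erase i) (C.erase j) ≤ ψ (Nn A R C - 6 + r + c) ∧
    (Qn A (R.erase i) (C.erase j) = ψ (Nn A R C - 6 + r + c) →
      Ext ((Nn A R C - 6 + r + c) % 6) A (R.erase i) (C.erase j)) := by
  have := good_iff.1 (IH_minor (A := A) hRC ih hi hj A)
  rwa [Nn_minor A hi hj h, hr, hc] at this

theorem cd_pos {A : α → β → Prop} {R : Finset α} {i : α} {j : β} (hi : i ∈ R) (h : A i j) :
    1 ≤ cd A R j := by
  unfold cd
  exact Finset.card_pos.2 ⟨i, by simp [hi, h]⟩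

theorem case0 {A : α → β → Prop} {R : Finset α} {C : Finset β} {i : α} (hi : i ∈ R)
    (hr : rd A C i = 0) : Good A R C := by
  apply Good_of_lt
  rw [P_row A C hi, Finset.card_eq_zero.1 hr]
  have := psi_pos (Nn A R C)
  simp
  positivity

theorem case1 {A : α → β → Prop} {R : Finset α} {C : Finset β} (hRC : R.card = C.card)
    (ih : IHp α β R.card) {i : α} (hi : i ∈ R)
    (hr : rd A C i = 1) : Good A R C := by
  obtain ⟨j, hj⟩ := Finset.card_eq_one.1 hr
  have hrow : ∀ j' ∈ C, (A i j' ↔ j' = j) := by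
    intro j' hj'
    have : j' ∈ C.filter (A i) ↔ j' ∈ ({j} : Finset β) := by rw [hj]
    simpa [hj'] using this
  have hjm : j ∈ C.filter (A i) := by rw [hj]; simp
  rw [Finset.mem_filter] at hjm
  have hQ := Qn_row A C hi
  rw [hj, Finset.sum_singleton] at hQ
  obtain ⟨m1, m2⟩ := Q_minor hRC ih hi hjm.1 hjm.2 hr rfl
  obtain ⟨-, -, f3, f4, f5, f6, -, -, -, f10, -⟩ := psi_facts (Nn A R C)
  rw [good_iff]
  obtain ⟨c, hc⟩ : ∃ c, c = cd A R j := ⟨_, rfl⟩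
  have hc1 : 1 ≤ cd A R j := cd_pos hi hjm.2
  rw [← hc] at m1 m2 hc1
  rcases Nat.lt_or_ge c 3 with h3 | h3
  · interval_cases c
    · have e : Nn A R C - 6 + (1:ℕ) + (1:ℕ) = Nn A R C - 4 := by push_cast; ring
      rw [e] at m1 m2
      refine ⟨by linarith, fun he => ?_⟩
      have e2 := m2 (by linarith)
      have e3 := f4 (by linarith)
      obtain ⟨i', hi'⟩ := Finset.card_eq_one.1 hc.symm
      have hcol : ∀ k ∈ R, (A k j ↔ k = i') := by
        intro k hk
        have : k ∈ R.filter (fun k => A k j) ↔ k ∈ ({i'} : Finset α) := by rw [hi']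
        simpa [hk] using this
      have hii : i = i' := (hcol i hi).1 hjm.2
      subst hii
      have hiso : Iso1 A R C i j := by
        refine ⟨hi, hjm.1, fun k' hk' j' hj' hh => ?_⟩
        rcases hh with rfl | rfl
        · rw [hrow _ hj']; simp
        · rw [hcol _ hk']; simp
      refine ⟨fun _ => by omega, fun _ => by omega, fun hq => ?_, fun hq => ?_⟩
      · exact ⟨i, j, hiso, e2.1 (by omega)⟩
      · exact Or.inl ⟨i, j, hiso, e2.2.1 (by omega)⟩
    · have e : Nn A R C - 6 + (1:ℕ) + (2:ℕ) = Nn A R C - 3 := by push_cast; ring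
      rw [e] at m1 m2
      refine ⟨by linarith, fun he => Ext_trivial (Or.inr (f6 (by linarith)))⟩
  · have e : ψ (Nn A R C - 6 + (1:ℕ) + c) ≤ ψ (Nn A R C - 2) := psi_anti (by push_cast; omega)
    have := psi_pos (Nn A R C - 4)
    exact ⟨by linarith, fun he => by linarith⟩

theorem case4 {A : α → β → Prop} {R : Finset α} {C : Finset β} (hRC : R.card = C.card)
    (ih : IHp α β R.card) {i : α} (hi : i ∈ R) (hr : 4 ≤ rd A C i)
    (hmin : ∀ j ∈ C, rd A C i ≤ cd A R j) : Good A R C := by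
  have hQ := Qn_row A C hi
  have hb := psi_big (Nn A R C) _ hr
  have hs : ∑ j ∈ C.filter (A i), Qn A (R.erase i) (C.erase j) ≤
      ∑ j ∈ C.filter (A i), ψ (Nn A R C - 6 + 2 * (rd A C i : ℕ)) := by
    apply Finset.sum_le_sum
    intro j hj
    rw [Finset.mem_filter] at hj
    refine (Q_minor hRC ih hi hj.1 hj.2 rfl rfl).1.trans (psi_anti ?_)
    have := hmin j hj.1
    omega
  rw [Finset.sum_const, nsmul_eq_mul] at hs
  rw [good_iff]
  have hs' : ∑ j ∈ C.filter (A i), Qn A (R.erase i) (C.erase j) ≤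
    (rd A C i : ℚ) * ψ (Nn A R C - 6 + 2 * (rd A C i : ℕ)) := hs
  exact ⟨by linarith, fun he => by linarith⟩

/-- put a row and a column around a block -/
theorem assemble {A : α → β → Prop} {R : Finset α} {C : Finset β} {i : α} {j1 j' : β}
    {S : Finset α} {T : Finset β} (hi : i ∈ R) (hj : j1 ∈ C)
    (hJ : JS A (R.erase i) (C.erase j1)) (hb : Block A (R.erase i) (C.erase j1) S T)
    (hj' : j' ∈ T)
    (hrow : ∀ j ∈ C, (A i j ↔ j = j1 ∨ (j ∈ T ∧ j ≠ j')))
    (hcol : ∀ k ∈ R, (A k j1 ↔ k ∈ insert i S)) : EH (T.card + 1) A R C := by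
  have hJ' := JS_rem hb hJ
  obtain ⟨b1, b2, b3, b4, b5⟩ := hb
  have hiS : i ∉ S := fun h => by simpa using b1 h
  have hjT : j1 ∉ T := fun h => by simpa using b2 h
  refine ⟨insert i S, insert j1 T, ⟨?_, ?_, ?_⟩, ⟨?_, ?_, i, by simp, j', by simp [hj'], ?_⟩, ?_⟩
  · exact Finset.insert_subset hi (b1.trans (Finset.erase_subset _ _))
  · exact Finset.insert_subset hj (b2.trans (Finset.erase_subset _ _))
  · intro k hk l hl ha
    have h1 := b5 k
    have h2 := hrow l hl
    have h3 := hcol k hk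
    simp only [Finset.mem_insert, Finset.mem_erase] at *
    grind
  · rw [Finset.card_insert_of_notMem hiS, b3]
  · rw [Finset.card_insert_of_notMem hjT]
  · intro k hk l hl
    have h1 := b5 k
    have h2 := hrow l
    have h3 := hcol k
    have h4 := @b1 k
    have h5 := @b2 l
    have h6 := @b2 j'
    simp only [Finset.mem_insert, Finset.mem_erase] at *
    grind
  · have e1 : R \ insert i S = R.erase i \ S := by
      ext; simp only [Finset.mem_sdiff, Finset.mem_insert, Finset.mem_erase]; tauto
    have e2 : C \ insert j1 T = C.erase j1 \ T := by
      ext; simp only [Finset.mem_sdiff, Finset.mem_insert, Finset.mem_erase]; tauto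
    rw [e1, e2]
    exact (hJ')

/-- a column support of full cardinality -/
theorem col_eq {A : α → β → Prop} {R : Finset α} {j : β} {S : Finset α} (hS : S ⊆ R)
    (hA : ∀ k ∈ S, A k j) (hc : cd A R j ≤ S.card) : ∀ k ∈ R, (A k j ↔ k ∈ S) := by
  have hsub : S ⊆ R.filter (fun k => A k j) := fun k hk => by
    rw [Finset.mem_filter]; exact ⟨hS hk, hA k hk⟩
  have := Finset.eq_of_subset_of_card_le hsub hc
  intro k hk
  rw [this, Finset.mem_filter]
  tauto

/-- rows of the block contain the removed column -/
theorem row_has {A : α → β → Prop} {R : Finset α} {C : Finset β} {i : α} {j1 j2 : β}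
    {S : Finset α} {T : Finset β} (hj1 : j1 ∈ C) (hj2C : j2 ∈ C) (h12 : j1 ≠ j2)
    (hb : Block A (R.erase i) (C.erase j1) S T) (hj2 : j2 ∈ T)
    (hJ : JS A (R.erase i) (C.erase j2))
    (hdeg : ∀ j ∈ C.erase j2, T.card ≤ cd A (R.erase i) j) {k : α} (hk : k ∈ S) : A k j1 := by
  by_contra hn
  have h1 := Block_rd hb hk
  rw [rd_erase' A hn] at h1
  have hkj : A k j2 := by
    refine (hb.2.2.2.2 k (hb.1 hk) j2 ?_ (Or.inl hk)).2 ⟨hk, hj2⟩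
    simp [hj2C, h12.symm]
  have h2 := rd_erase A hj2C hkj
  obtain ⟨S', T', hb', hk'⟩ := hJ.1 k (hb.1 hk)
  have h3 := Block_rd hb' hk'
  obtain ⟨x, hx⟩ : T'.Nonempty := by
    rw [← Finset.card_pos]; have := hb'.2.2.2.1; omega
  have h4 := Block_cd hb' hx
  have := hdeg x (hb'.2.1 hx)
  omega

end step

section steptwo
open scoped Classical
set_option linter.unusedSectionVars false
set_option linter.unusedSimpArgs false
set_option linter.unusedVariables false

variable {α β : Type} [DecidableEq α] [DecidableEq β]

theorem Iso1_cd {A : α → β → Prop} {R : Finset α} {C : Finset β} {i : α} {j : β}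
    (h : Iso1 A R C i j) : cd A R j = 1 := by
  obtain ⟨h1, h2, h3⟩ := h
  rw [cd, Finset.card_eq_one]
  refine ⟨i, ?_⟩
  ext k
  have := h3 k
  simp only [Finset.mem_filter, Finset.mem_singleton]
  grind

theorem JS_cd {A : α → β → Prop} {R : Finset α} {C : Finset β} (h : JS A R C) {j : β}
    (hj : j ∈ C) : 2 ≤ cd A R j := by
  obtain ⟨S, T, hb, hm⟩ := h.2 j hj
  rw [Block_cd hb hm]
  have := hb.2.2.2.1
  omega

theorem case2a {A : α → β → Prop} {R : Finset α} {C : Finset β} (hRC : R.card = C.card)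
    (ih : IHp α β R.card) {i : α} (hi : i ∈ R) {j1 j2 : β} (h12 : j1 ≠ j2)
    (hf : C.filter (A i) = {j1, j2}) (hmin : ∀ j ∈ C, 2 ≤ cd A R j)
    (hc1 : 3 ≤ cd A R j1) (hc2 : 3 ≤ cd A R j2) : Good A R C := by
  have hrow : ∀ j' ∈ C, (A i j' ↔ j' = j1 ∨ j' = j2) := by
    intro j' hj'
    have : j' ∈ C.filter (A i) ↔ j' ∈ ({j1, j2} : Finset β) := by rw [hf]
    simpa [hj'] using this
  have hm1 : j1 ∈ C.filter (A i) := by rw [hf]; simp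
  have hm2 : j2 ∈ C.filter (A i) := by rw [hf]; simp
  rw [Finset.mem_filter] at hm1 hm2
  have hr : rd A C i = 2 := by rw [rd, hf, Finset.card_pair h12]
  have hQ := Qn_row A C hi
  rw [hf, Finset.sum_pair h12] at hQ
  obtain ⟨a1, a2⟩ := Q_minor hRC ih hi hm1.1 hm1.2 hr rfl
  obtain ⟨b1, b2⟩ := Q_minor hRC ih hi hm2.1 hm2.2 hr rfl
  obtain ⟨-, -, -, -, -, -, f7, f8, f9, -⟩ := psi_facts (Nn A R C)
  rw [good_iff]
  have hle : ∀ c : ℕ, 3 ≤ c → ψ (Nn A R C - 6 + (2:ℕ) + c) ≤ ψ (Nn A R C - 1) :=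
    fun c hc => psi_anti (by push_cast; omega)
  have hle' : ∀ c : ℕ, 4 ≤ c → ψ (Nn A R C - 6 + (2:ℕ) + c) ≤ ψ (Nn A R C) :=
    fun c hc => psi_anti (by push_cast; omega)
  have k1 := hle _ hc1
  have k2 := hle _ hc2
  by_cases h1 : 4 ≤ cd A R j1
  · have := hle' _ h1
    exact ⟨by linarith, fun he => by linarith⟩
  by_cases h2 : 4 ≤ cd A R j2
  · have := hle' _ h2
    exact ⟨by linarith, fun he => by linarith⟩
  have h1 : cd A R j1 = 3 := by omega
  have h2 : cd A R j2 = 3 := by omega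
  rw [h1] at a1 a2
  rw [h2] at b1 b2
  have e : Nn A R C - 6 + (2:ℕ) + (3:ℕ) = Nn A R C - 1 := by push_cast; ring
  rw [e] at a1 a2 b1 b2
  refine ⟨by linarith, fun he => ?_⟩
  have q := f8 (by linarith)
  have A2 := a2 (by linarith)
  have B2 := b2 (by linarith)
  refine ⟨fun _ => by omega, fun hq => ?_, fun _ => by omega, fun hq => ?_⟩
  · have J1 := A2.1 (by omega)
    have J2 := B2.1 (by omega)
    obtain ⟨S, T, hb, hj2T⟩ := J1.2 j2 (by simp [hm2.1, h12.symm])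
    have hcT := Block_cd hb hj2T
    have := cd_erase A hi hm2.2
    have hT2 : T.card = 2 := by omega
    have hS2 : S.card = 2 := by rw [hb.2.2.1, hT2]
    have hSub : S ⊆ R.erase i := hb.1
    have hTub : T ⊆ C.erase j1 := hb.2.1
    have hcol : ∀ k ∈ R, (A k j1 ↔ k ∈ insert i S) := by
      apply col_eq
      · exact Finset.insert_subset hi (hSub.trans (Finset.erase_subset _ _))
      · intro k hk
        rcases Finset.mem_insert.1 hk with rfl | hk
        · exact hm1.2
        · exact row_has hm1.1 hm2.1 h12 hb hj2T J2 (fun j hj => by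
            rw [hT2]; exact JS_cd J2 hj) hk
      · rw [Finset.card_insert_of_notMem (fun h => by simpa using hSub h)]
        omega
    obtain ⟨j', hj'⟩ : (T.erase j2).Nonempty := by
      rw [← Finset.card_pos, Finset.card_erase_of_mem hj2T]; omega
    have hj'1 := Finset.mem_of_mem_erase hj'
    have hT : T = {j2, j'} := by
      symm
      apply Finset.eq_of_subset_of_card_le
      · intro x hx
        simp only [Finset.mem_insert, Finset.mem_singleton] at hx
        rcases hx with rfl | rfl
        · exact hj2T
        · exact hj'1
      · rw [Finset.card_pair (Finset.ne_of_mem_erase hj').symm]; omega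
    have := assemble hi hm1.1 J1 hb hj'1 (by
      intro j hj
      rw [hrow j hj]
      have := Finset.ne_of_mem_erase hj'
      subst hT
      simp only [Finset.mem_insert, Finset.mem_singleton]
      grind) hcol
    rwa [hT2] at this
  · exfalso
    obtain ⟨k, l, hiso, -⟩ := A2.2.2.1 (by omega)
    have h1 := Iso1_cd hiso
    have hl := hiso.2.1
    rw [Finset.mem_erase] at hl
    by_cases hl2 : l = j2
    · subst hl2
      have := cd_erase A hi hm2.2
      omega
    · have hn : ¬ A i l := by rw [hrow l hl.2]; tauto
      rw [cd_erase' A hn] at h1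
      have := hmin l hl.2
      omega

theorem case2b {A : α → β → Prop} {R : Finset α} {C : Finset β} (hRC : R.card = C.card)
    (ih : IHp α β R.card) {i : α} (hi : i ∈ R) {j1 j2 : β} (h12 : j1 ≠ j2)
    (hf : C.filter (A i) = {j1, j2}) (hminR : ∀ k ∈ R, 2 ≤ rd A C k)
    (hmin : ∀ j ∈ C, 2 ≤ cd A R j)
    (hc1 : cd A R j1 = 2) : Good A R C := by
  have hrow : ∀ j' ∈ C, (A i j' ↔ j' = j1 ∨ j' = j2) := by
    intro j' hj'
    have : j' ∈ C.filter (A i) ↔ j' ∈ ({j1, j2} : Finset β) := by rw [hf]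
    simpa [hj'] using this
  have hm1 : j1 ∈ C.filter (A i) := by rw [hf]; simp
  have hm2 : j2 ∈ C.filter (A i) := by rw [hf]; simp
  rw [Finset.mem_filter] at hm1 hm2
  have hr : rd A C i = 2 := by rw [rd, hf, Finset.card_pair h12]
  have hQ := Qn_row A C hi
  rw [hf, Finset.sum_pair h12] at hQ
  -- the other row of column j1
  obtain ⟨i', hi'⟩ : ((R.filter (fun k => A k j1)).erase i).Nonempty := by
    rw [← Finset.card_pos, Finset.card_erase_of_mem (by simp [hi, hm1.2])]
    have : (R.filter (fun k => A k j1)).card = 2 := hc1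
    omega
  rw [Finset.mem_erase, Finset.mem_filter] at hi'
  obtain ⟨hii, hiR, hiA⟩ := hi'
  have hcol : ∀ k ∈ R, (A k j1 ↔ k ∈ ({i, i'} : Finset α)) := by
    apply col_eq
    · intro k hk
      simp only [Finset.mem_insert, Finset.mem_singleton] at hk
      rcases hk with rfl | rfl <;> assumption
    · intro k hk
      simp only [Finset.mem_insert, Finset.mem_singleton] at hk
      rcases hk with rfl | rfl
      · exact hm1.2
      · exact hiA
    · rw [Finset.card_pair hii.symm]; omega
  have hiE : i' ∈ R.erase i := by simp [hii, hiR]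
  have hj1E : j1 ∈ C.erase j2 := by simp [h12, hm1.1]
  have hj2E : j2 ∈ C.erase j1 := by simp [h12.symm, hm2.1]
  -- second minor reduces further
  have hY : P A (R.erase i) (C.erase j2) = P A ((R.erase i).erase i') ((C.erase j1).erase j2) := by
    rw [P_col A (R.erase i) hj1E]
    have : (R.erase i).filter (fun k => A k j1) = {i'} := by
      ext k
      have := hcol k
      simp only [Finset.mem_filter, Finset.mem_erase, Finset.mem_insert,
        Finset.mem_singleton] at *
      grind
    rw [this, Finset.sum_singleton, Finset.erase_right_comm (a := j2)]
  have hcE1 := Finset.card_erase_add_one hi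
  have hcE2 := Finset.card_erase_add_one hiE
  have hcE3 := Finset.card_erase_add_one hm1.1
  have hcE4 := Finset.card_erase_add_one hj2E
  obtain ⟨-, -, -, -, f5, f6, -, -, -, f10, f11, -⟩ := psi_facts (Nn A R C)
  by_cases hA2 : A i' j2
  · by_cases hc2 : cd A R j2 = 2
    · have hcol2 : ∀ k ∈ R, (A k j2 ↔ k ∈ ({i, i'} : Finset α)) := by
        apply col_eq
        · intro k hk
          simp only [Finset.mem_insert, Finset.mem_singleton] at hk
          rcases hk with rfl | rfl <;> assumption
        · intro k hk
          simp only [Finset.mem_insert, Finset.mem_singleton] at hk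
          rcases hk with rfl | rfl
          · exact hm2.2
          · exact hA2
        · rw [Finset.card_pair hii.symm]; omega
      have hCB : ColB A R C {i, i'} {j1, j2} := by
        refine ⟨?_, ?_, ?_, ?_⟩
        · intro k hk
          simp only [Finset.mem_insert, Finset.mem_singleton] at hk
          rcases hk with rfl | rfl <;> assumption
        · intro k hk
          simp only [Finset.mem_insert, Finset.mem_singleton] at hk
          rcases hk with rfl | rfl
          · exact hm1.1
          · exact hm2.1
        · rw [Finset.card_pair hii.symm, Finset.card_pair h12]
        · intro k hk j hj
          simp only [Finset.mem_insert, Finset.mem_singleton] at hj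
          rcases hj with rfl | rfl
          · exact hcol k hk
          · exact hcol2 k hk
      have d1 := Finset.card_sdiff_add_card_eq_card hCB.1
      have d2 := Finset.card_sdiff_add_card_eq_card hCB.2.1
      rw [Finset.card_pair hii.symm] at d1
      rw [Finset.card_pair h12] at d2
      exact reduceCol hCB (Or.inl (Finset.card_pair h12)) (ih _ _ _ (by omega) (by omega))
    by_cases hr2 : rd A C i' = 2
    · have hrow2 : ∀ k ∈ C, (A i' k ↔ k ∈ ({j1, j2} : Finset β)) := by
        apply col_eq (A := tr A) (j := i')
        · intro k hk
          simp only [Finset.mem_insert, Finset.mem_singleton] at hk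
          rcases hk with rfl | rfl
          · exact hm1.1
          · exact hm2.1
        · intro k hk
          simp only [Finset.mem_insert, Finset.mem_singleton] at hk
          rcases hk with rfl | rfl
          · exact hiA
          · exact hA2
        · rw [Finset.card_pair h12]; exact hr2.le
      have hCB : ColB (tr A) C R {j1, j2} {i, i'} := by
        refine ⟨?_, ?_, ?_, ?_⟩
        · intro k hk
          simp only [Finset.mem_insert, Finset.mem_singleton] at hk
          rcases hk with rfl | rfl
          · exact hm1.1
          · exact hm2.1
        · intro k hk
          simp only [Finset.mem_insert, Finset.mem_singleton] at hk
          rcases hk with rfl | rfl <;> assumption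
        · rw [Finset.card_pair hii.symm, Finset.card_pair h12]
        · intro k hk j hj
          simp only [Finset.mem_insert, Finset.mem_singleton] at hj
          rcases hj with rfl | rfl
          · rw [tr, hrow k hk]; simp
          · exact hrow2 k hk
      have d1 := Finset.card_sdiff_add_card_eq_card hCB.1
      have d2 := Finset.card_sdiff_add_card_eq_card hCB.2.1
      rw [Finset.card_pair h12] at d1
      rw [Finset.card_pair hii.symm] at d2
      exact reduceRow hRC hCB (Or.inl (Finset.card_pair h12)) (ih _ _ _ (by omega) (by omega))
    have hc2 : 3 ≤ cd A R j2 := by have := hmin j2 hm2.1; omega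
    have hr2 : 3 ≤ rd A C i' := by have := hminR i' hiR; omega
    obtain ⟨a1, -⟩ := Q_minor hRC ih hi hm1.1 hm1.2 hr hc1
    obtain ⟨y1, -⟩ := good_iff.1 (ih A ((R.erase i).erase i') ((C.erase j1).erase j2)
      (by omega) (by omega))
    have hN : Nn A ((R.erase i).erase i') ((C.erase j1).erase j2) =
        Nn A R C - 10 + rd A C i' + cd A R j2 := by
      rw [Nn_minor A hiE hj2E hA2, Nn_minor A hi hm1.1 hm1.2, hr, hc1]
      have := rd_erase A hm1.1 hiA
      have := cd_erase A hi hm2.2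
      push_cast
      omega
    have hle : ψ (Nn A R C - 10 + rd A C i' + cd A R j2) ≤ ψ (Nn A R C - 4) :=
      psi_anti (by omega)
    rw [hN] at y1
    have hYq : 3 * Qn A (R.erase i) (C.erase j2) =
        Qn A ((R.erase i).erase i') ((C.erase j1).erase j2) := by
      unfold Qn
      rw [hY, ← hcE2, pow_succ]
      field_simp
    have e : Nn A R C - 6 + (2:ℕ) + (2:ℕ) = Nn A R C - 2 := by push_cast; ring
    rw [e] at a1
    rw [good_iff]
    exact ⟨by linarith, fun he => Ext_trivial (f11 (by linarith))⟩
  · obtain ⟨g1, -⟩ := good_iff.1 (IH_minor (A := A) hRC ih hi hm1.1 (addOne A i' j2))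
    have hN : Nn (addOne A i' j2) (R.erase i) (C.erase j1) = Nn A R C - 3 := by
      have h1 := Nn_minor A hi hm1.1 hm1.2
      have h2 := sg_addOne A hiE hj2E hA2
      rw [hr, hc1] at h1
      unfold Nn at *
      push_cast at *
      omega
    have hP := P_addOne A hiE hj2E hA2
    have hQ2 : Qn (addOne A i' j2) (R.erase i) (C.erase j1) =
        Qn A (R.erase i) (C.erase j1) + Qn A (R.erase i) (C.erase j2) := by
      unfold Qn
      rw [hP, hY]
      push_cast
      ring
    rw [hN] at g1
    rw [good_iff]
    exact ⟨by linarith, fun he => Ext_trivial (Or.inr (f6 (by linarith)))⟩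

theorem case2 {A : α → β → Prop} {R : Finset α} {C : Finset β} (hRC : R.card = C.card)
    (ih : IHp α β R.card) {i : α} (hi : i ∈ R) (hr : rd A C i = 2)
    (hminR : ∀ k ∈ R, 2 ≤ rd A C k) (hmin : ∀ j ∈ C, 2 ≤ cd A R j) : Good A R C := by
  obtain ⟨j1, j2, h12, hf⟩ := Finset.card_eq_two.1 hr
  have hm1 : j1 ∈ C.filter (A i) := by rw [hf]; simp
  have hm2 : j2 ∈ C.filter (A i) := by rw [hf]; simp
  rw [Finset.mem_filter] at hm1 hm2
  have h1 := hmin j1 hm1.1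
  have h2 := hmin j2 hm2.1
  by_cases c1 : cd A R j1 = 2
  · exact case2b hRC ih hi h12 hf hminR hmin c1
  by_cases c2 : cd A R j2 = 2
  · exact case2b hRC ih hi h12.symm (by rw [hf, Finset.pair_comm]) hminR hmin c2
  exact case2a hRC ih hi h12 hf hmin (by omega) (by omega)

end steptwo

section stepthree
open scoped Classical
set_option linter.unusedSectionVars false
set_option linter.unusedSimpArgs false
set_option linter.unusedVariables false

variable {α β : Type} [DecidableEq α] [DecidableEq β]

/-- a column of degree two in a block has a partner -/
theorem Block_partner {A : α → β → Prop} {R : Finset α} {C : Finset β} {S : Finset α} {T : Finset β}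
    (h : Block A R C S T) {j : β} (hj : j ∈ T) (hd : cd A R j = 2) :
    ∃ x ∈ T, x ≠ j ∧ T = {j, x} ∧ cd A R x = 2 ∧ ∀ i ∈ R, (A i j ↔ A i x) := by
  have h2 : T.card = 2 := by rw [← Block_cd h hj, hd]
  obtain ⟨x, hx⟩ : (T.erase j).Nonempty := by
    rw [← Finset.card_pos, Finset.card_erase_of_mem hj]; omega
  rw [Finset.mem_erase] at hx
  refine ⟨x, hx.2, hx.1, ?_, by rw [Block_cd h hx.2, h2], ?_⟩
  · symm
    apply Finset.eq_of_subset_of_card_le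
    · intro y hy
      simp only [Finset.mem_insert, Finset.mem_singleton] at hy
      rcases hy with rfl | rfl
      · exact hj
      · exact hx.2
    · rw [Finset.card_pair hx.1.symm]; omega
  · intro i hi
    have a := h.2.2.2.2 i hi j (h.2.1 hj) (Or.inr hj)
    have b := h.2.2.2.2 i hi x (h.2.1 hx.2) (Or.inr hx.2)
    tauto

/-- column degrees in a holed block -/
theorem HB_cd {A : α → β → Prop} {R : Finset α} {C : Finset β} {S : Finset α} {T : Finset β}
    {k : ℕ} (hs : Split A R C S T) (h : HB A k S T) :
    ∃ j0 ∈ T, cd A R j0 + 1 = k ∧ ∀ j ∈ T, j ≠ j0 → cd A R j = k := by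
  obtain ⟨s1, s2, s3⟩ := hs
  obtain ⟨h1, h2, i0, hi0, j0, hj0, h3⟩ := h
  refine ⟨j0, hj0, ?_, ?_⟩
  · rw [← h1, ← Finset.card_erase_add_one hi0, cd]
    congr 2
    ext i
    have a := s3 i
    have b := h3 i
    have c := @s1 i
    have d := @s2 j0
    simp only [Finset.mem_filter, Finset.mem_erase]
    grind
  · intro j hj hne
    rw [← h1, cd]
    congr 1
    ext i
    have a := s3 i
    have b := h3 i
    have c := @s1 i
    have d := @s2 j
    simp only [Finset.mem_filter]
    grind

theorem JS_block_rest {A : α → β → Prop} {R : Finset α} {C : Finset β} {S : Finset α} {T : Finset β}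
    (hs : Split A R C S T) (h : JS A (R \ S) (C \ T)) {j : β} (hj : j ∈ C) (hj' : j ∉ T) :
    ∃ S' T', Block A R C S' T' ∧ j ∈ T' ∧ T' ⊆ C \ T := by
  obtain ⟨S', T', hb, hm⟩ := h.2 j (by simp [hj, hj'])
  exact ⟨S', T', Block_lift hs hb, hm, hb.2.1⟩

theorem twin {A : α → β → Prop} {R : Finset α} {C : Finset β} {q : ℤ}
    (hq : q = 0 ∨ q = 1 ∨ q = 4 ∨ q = 5) (h : Ext q A R C) {j2 j3 : β} (h23 : j2 ≠ j3)
    (hj2 : j2 ∈ C) (hj3 : j3 ∈ C) (hd2 : cd A R j2 = 2) (hd3 : cd A R j3 = 2)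
    (hd : ∀ j ∈ C, j ≠ j2 → j ≠ j3 → 3 ≤ cd A R j) : ∀ i ∈ R, (A i j2 ↔ A i j3) := by
  have hge : ∀ j ∈ C, 2 ≤ cd A R j := by
    intro j hj
    by_cases h2 : j = j2
    · rw [h2, hd2]
    by_cases h3 : j = j3
    · rw [h3, hd3]
    have := hd j hj h2 h3
    omega
  have hiso : ∀ i j, ¬ Iso1 A R C i j := by
    intro i j hh
    have h1 := Iso1_cd hh
    have h2 := hge j hh.2.1
    omega
  have hX : ∀ x ∈ C, cd A R x = 2 → x = j2 ∨ x = j3 := by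
    intro x hx hc
    by_contra hcon
    push Not at hcon
    have := hd x hx hcon.1 hcon.2
    omega
  rcases hq with hq | hq | hq | hq
  · obtain ⟨S, T, hb, hm⟩ := (h.1 hq).2 j2 hj2
    obtain ⟨x, hxT, hx1, -, hx2, hx3⟩ := Block_partner hb hm hd2
    rcases hX x (hb.2.1 hxT) hx2 with rfl | rfl
    · exact absurd rfl hx1
    · exact hx3
  · exfalso
    obtain ⟨S, T, hs, hh, hJ⟩ := h.2.1 hq
    obtain ⟨j0, hj0, hc0, hc1⟩ := HB_cd hs hh
    have key : ∀ x ∈ C, x ≠ j0 → cd A R x = 2 → ∃ y ∈ C, y ≠ j0 ∧ y ≠ x ∧ cd A R y = 2 := by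
      intro x hx hx0 hc
      have hxT : x ∉ T := fun hxT => by have := hc1 x hxT hx0; omega
      obtain ⟨S', T', hb, hm, hsub⟩ := JS_block_rest hs hJ hx hxT
      obtain ⟨y, hy, hy1, -, hy2, -⟩ := Block_partner hb hm hc
      have := hsub hy
      rw [Finset.mem_sdiff] at this
      exact ⟨y, this.1, fun e => this.2 (e ▸ hj0), hy1, hy2⟩
    have hj0X := hX j0 (hs.2.1 hj0) (by omega)
    rcases hj0X with rfl | rfl
    · obtain ⟨y, hy, y1, y2, y3⟩ := key j3 hj3 h23.symm hd3
      rcases hX y hy y3 with rfl | rfl <;> contradiction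
    · obtain ⟨y, hy, y1, y2, y3⟩ := key j2 hj2 h23 hd2
      rcases hX y hy y3 with rfl | rfl <;> contradiction
  · obtain ⟨i, j, hh, -⟩ := h.2.2.1 hq
    exact absurd hh (hiso i j)
  · rcases h.2.2.2 hq with h | h | h
    · obtain ⟨i, j, hh, -⟩ := h
      exact absurd hh (hiso i j)
    · obtain ⟨S, T, hs, hh, hJ⟩ := h
      obtain ⟨j0, hj0, hc0, hc1⟩ := HB_cd hs hh
      have hxT : j2 ∉ T := fun hxT => by
        by_cases e : j2 = j0
        · rw [e] at hd2; omega
        · have := hc1 j2 hxT e; omega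
      obtain ⟨S', T', hb, hm, hsub⟩ := JS_block_rest hs hJ hj2 hxT
      obtain ⟨x, hxT, hx1, -, hx2, hx3⟩ := Block_partner hb hm hd2
      rcases hX x (hb.2.1 hxT) hx2 with rfl | rfl
      · exact absurd rfl hx1
      · exact hx3
    · obtain ⟨k, hk, l, hl, hkl, hJ⟩ := h
      have hcdl : ∀ x, x ≠ l → cd (delOne A k l) R x = cd A R x := by
        intro x hx
        unfold cd
        congr 1
        ext i
        simp [delOne, hx]
      have hcdl' : cd (delOne A k l) R l + 1 = cd A R l := by
        unfold cd
        rw [← Finset.card_erase_add_one (s := R.filter (fun i => A i l)) (a := k) (by simp [hk, hkl])]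
        congr 2
        ext i
        simp only [delOne, Finset.mem_filter, Finset.mem_erase]
        tauto
      have hl3 : 2 ≤ cd (delOne A k l) R l := JS_cd hJ hl
      have l2 : j2 ≠ l := fun e => by rw [e] at hd2; omega
      have l3 : j3 ≠ l := fun e => by rw [e] at hd3; omega
      have hX' : ∀ x ∈ C, cd (delOne A k l) R x = 2 → x = j2 ∨ x = j3 ∨ x = l := by
        intro x hx hc
        by_cases e : x = l
        · exact Or.inr (Or.inr e)
        · rw [hcdl x e] at hc
          have := hX x hx hc
          tauto
      obtain ⟨S, T, hb, hm⟩ := hJ.2 j2 hj2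
      obtain ⟨S', T', hb', hm'⟩ := hJ.2 j3 hj3
      obtain ⟨x, hxT, hx1, hTx, hx2, hx3⟩ := Block_partner hb hm (by rw [hcdl _ l2, hd2])
      obtain ⟨y, hyT, hy1, hTy, hy2, hy3⟩ := Block_partner hb' hm' (by rw [hcdl _ l3, hd3])
      have res : x = j3 := by
        by_contra hne
        have hxl : x = l := by
          have := hX' x (hb.2.1 hxT) hx2
          tauto
        subst hxl
        have hyy := hX' y (hb'.2.1 hyT) hy2
        have hTT : T = T' := by
          rcases Block_disj hb hb' with hh | hh
          · exact hh.2
          · exfalso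
            rcases hyy with rfl | rfl | rfl
            · exact Finset.disjoint_left.1 hh.2 hm hyT
            · exact hy1 rfl
            · exact Finset.disjoint_left.1 hh.2 hxT hyT
        rw [← hTT, hTx] at hm'
        simp only [Finset.mem_insert, Finset.mem_singleton] at hm'
        rcases hm' with e | e
        · exact h23 e.symm
        · exact l3 e
      subst res
      intro i hi
      have := hx3 i hi
      simp only [delOne] at this
      tauto

theorem cd_minor {A : α → β → Prop} {R : Finset α} {i : α} {j : β} (hi : i ∈ R) :
    (A i j → cd A (R.erase i) j + 1 = cd A R j) ∧ (¬ A i j → cd A (R.erase i) j = cd A R j) :=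
  ⟨fun h => cd_erase A hi h, fun h => cd_erase' A h⟩

/-- three columns, class 5, first column of degree four -/
theorem case3five {A : α → β → Prop} {R : Finset α} {C : Finset β} (hRC : R.card = C.card)
    (ih : IHp α β R.card) {i : α} (hi : i ∈ R) {j1 j2 j3 : β} (h12 : j1 ≠ j2) (h13 : j1 ≠ j3)
    (h23 : j2 ≠ j3) (hj1 : j1 ∈ C) (hj2 : j2 ∈ C) (hj3 : j3 ∈ C)
    (hrow : ∀ j ∈ C, (A i j ↔ j = j1 ∨ j = j2 ∨ j = j3))
    (hminR : ∀ k ∈ R, 3 ≤ rd A C k) (hmin : ∀ j ∈ C, 3 ≤ cd A R j)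
    (c1 : cd A R j1 = 4) (c2 : cd A R j2 ≤ 4) (c3 : cd A R j3 ≤ 4)
    (J1 : JS A (R.erase i) (C.erase j1))
    (J2 : cd A R j2 = 4 → JS A (R.erase i) (C.erase j2))
    (J3 : cd A R j3 = 4 → JS A (R.erase i) (C.erase j3)) :
    Good A R C ∨ EH 4 A R C := by
  have a1 : A i j1 := (hrow j1 hj1).2 (by simp)
  have a2 : A i j2 := (hrow j2 hj2).2 (by simp)
  have a3 : A i j3 := (hrow j3 hj3).2 (by simp)
  have d1 := cd_erase A hi a1
  have d2 := cd_erase A hi a2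
  have d3 := cd_erase A hi a3
  have m2 := hmin j2 hj2
  have m3 := hmin j3 hj3
  have e2 : j2 ∈ C.erase j1 := by simp [hj2, h12.symm]
  have e3 : j3 ∈ C.erase j1 := by simp [hj3, h13.symm]
  have hoth : ∀ j ∈ C, j ≠ j1 → j ≠ j2 → j ≠ j3 → 3 ≤ cd A (R.erase i) j := by
    intro j hj n1 n2 n3
    rw [cd_erase' A (by rw [hrow j hj]; tauto)]
    exact hmin j hj
  obtain ⟨S, T, hb, hm⟩ := J1.2 j2 e2
  have hTc := Block_cd hb hm
  have hSub : S ⊆ R.erase i := hb.1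
  have hiS : i ∉ S := fun h => by simpa using hSub h
  have hjT : j1 ∉ T := fun h => by simpa using hb.2.1 h
  by_cases k2 : cd A R j2 = 4
  · by_cases k3 : cd A R j3 = 4
    · -- all four
      have J2 := J2 k2
      have J3 := J3 k3
      have hall : ∀ j ∈ C, 3 ≤ cd A (R.erase i) j := by
        intro j hj
        by_cases n1 : j = j1
        · rw [n1]; omega
        by_cases n2 : j = j2
        · rw [n2]; omega
        by_cases n3 : j = j3
        · rw [n3]; omega
        exact hoth j hj n1 n2 n3
      have hT3 : T.card = 3 := by omega
      have hS1 : ∀ k ∈ S, A k j1 := fun k hk => row_has hj1 hj2 h12 hb hm J2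
        (fun j hj => by rw [hT3]; exact hall j (Finset.mem_of_mem_erase hj)) hk
      have hScard : S.card = 3 := by rw [hb.2.2.1, hT3]
      have hcol : ∀ k ∈ R, (A k j1 ↔ k ∈ insert i S) := by
        apply col_eq
        · exact Finset.insert_subset hi (hSub.trans (Finset.erase_subset _ _))
        · intro k hk
          rcases Finset.mem_insert.1 hk with rfl | hk
          · exact a1
          · exact hS1 k hk
        · rw [Finset.card_insert_of_notMem hiS]
          omega
      have hj3T : j3 ∈ T := by
        obtain ⟨S', T', hb', hm'⟩ := J1.2 j3 e3
        rcases Block_disj hb hb' with hh | hh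
        · rw [hh.2]; exact hm'
        · exfalso
          have hT3' : T'.card = 3 := by have := Block_cd hb' hm'; omega
          obtain ⟨k, hk⟩ : S'.Nonempty := by
            rw [← Finset.card_pos, hb'.2.2.1, hT3']; omega
          have hkA : A k j1 := row_has hj1 hj3 h13 hb' hm' J3
            (fun j hj => by rw [hT3']; exact hall j (Finset.mem_of_mem_erase hj)) hk
          have hkR := hb'.1 hk
          rw [Finset.mem_erase] at hkR
          have := (hcol k hkR.2).1 hkA
          rcases Finset.mem_insert.1 this with e | e
          · exact hkR.1 e
          · exact Finset.disjoint_left.1 hh.1 e hk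
      obtain ⟨j', hj'⟩ : ((T.erase j2).erase j3).Nonempty := by
        rw [← Finset.card_pos, Finset.card_erase_of_mem (by simp [hj3T, h23.symm]),
          Finset.card_erase_of_mem hm]
        omega
      simp only [Finset.mem_erase] at hj'
      have hT : T = {j2, j3, j'} := by
        symm
        apply Finset.eq_of_subset_of_card_le
        · intro x hx
          simp only [Finset.mem_insert, Finset.mem_singleton] at hx
          rcases hx with rfl | rfl | rfl
          · exact hm
          · exact hj3T
          · exact hj'.2.2
        · rw [Finset.card_eq_three.2 ⟨j2, j3, j', h23, hj'.2.1.symm, hj'.1.symm, rfl⟩]; omega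
      right
      have := assemble hi hj1 J1 hb hj'.2.2 (by
        intro j hj
        rw [hrow j hj, hT]
        simp only [Finset.mem_insert, Finset.mem_singleton]
        grind) hcol
      rwa [hT3] at this
    · -- contradiction
      exfalso
      have k3 : cd A (R.erase i) j3 = 2 := by omega
      obtain ⟨S', T', hb', hm'⟩ := J1.2 j3 e3
      obtain ⟨x, hxT, hx1, -, hx2, hx3⟩ := Block_partner hb' hm' k3
      have hxC := hb'.2.1 hxT
      rw [Finset.mem_erase] at hxC
      by_cases n2 : x = j2
      · rw [n2] at hx2; omega
      · have := hoth x hxC.2 hxC.1 n2 hx1; omega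
  · have hk2 : cd A (R.erase i) j2 = 2 := by omega
    obtain ⟨x, hxT, hx1, hTx, hx2, hx3⟩ := Block_partner hb hm hk2
    have hxC := hb.2.1 hxT
    rw [Finset.mem_erase] at hxC
    by_cases n3 : x = j3
    · subst n3
      left
      have hT2 : T.card = 2 := by omega
      have hS2 : S.card = 2 := by rw [hb.2.2.1, hT2]
      have hS1 : ∀ k ∈ S, A k j1 := by
        intro k hk
        by_contra hn
        have h1 := Block_rd hb hk
        rw [rd_erase' A hn] at h1
        have hkR := hSub hk
        rw [Finset.mem_erase] at hkR
        have := hminR k hkR.2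
        omega
      have hCB : ColB (tr A) C R (insert j1 T) (insert i S) := by
        refine ⟨?_, ?_, ?_, ?_⟩
        · exact Finset.insert_subset hj1 (hb.2.1.trans (Finset.erase_subset _ _))
        · exact Finset.insert_subset hi (hSub.trans (Finset.erase_subset _ _))
        · rw [Finset.card_insert_of_notMem hiS, Finset.card_insert_of_notMem hjT]; omega
        · intro j hj k hk
          rw [tr]
          rcases Finset.mem_insert.1 hk with rfl | hk
          · rw [hrow j hj, hTx]; simp
          · by_cases ej : j = j1
            · subst ej
              simp [hS1 k hk]
            · have := hb.2.2.2.2 k (hSub hk) j (by simp [hj, ej]) (Or.inl hk)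
              rw [this]
              simp [hk, ej]
      have d1 := Finset.card_sdiff_add_card_eq_card hCB.1
      have d2 := Finset.card_sdiff_add_card_eq_card hCB.2.1
      rw [Finset.card_insert_of_notMem hjT] at d1
      rw [Finset.card_insert_of_notMem hiS] at d2
      exact reduceRow hRC hCB (Or.inr (by rw [Finset.card_insert_of_notMem hjT]; omega))
        (ih _ _ _ (by omega) (by omega))
    · exfalso
      have := hoth x hxC.2 hxC.1 hx1 n3; omega

theorem case3 {A : α → β → Prop} {R : Finset α} {C : Finset β} (hRC : R.card = C.card)
    (ih : IHp α β R.card) {i : α} (hi : i ∈ R) (hr : rd A C i = 3)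
    (hminR : ∀ k ∈ R, 3 ≤ rd A C k) (hmin : ∀ j ∈ C, 3 ≤ cd A R j) : Good A R C := by
  obtain ⟨j1, j2, j3, h12, h13, h23, hf⟩ := Finset.card_eq_three.1 hr
  have hrow : ∀ j' ∈ C, (A i j' ↔ j' = j1 ∨ j' = j2 ∨ j' = j3) := by
    intro j' hj'
    have : j' ∈ C.filter (A i) ↔ j' ∈ ({j1, j2, j3} : Finset β) := by rw [hf]
    simpa [hj'] using this
  have hm1 : j1 ∈ C.filter (A i) := by rw [hf]; simp
  have hm2 : j2 ∈ C.filter (A i) := by rw [hf]; simp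
  have hm3 : j3 ∈ C.filter (A i) := by rw [hf]; simp
  rw [Finset.mem_filter] at hm1 hm2 hm3
  obtain ⟨hj1, a1⟩ := hm1
  obtain ⟨hj2, a2⟩ := hm2
  obtain ⟨hj3, a3⟩ := hm3
  have hQ := Qn_row A C hi
  rw [hf, Finset.sum_insert (by simp [h12, h13]), Finset.sum_pair h23] at hQ
  obtain ⟨x1, y1⟩ := Q_minor hRC ih hi hj1 a1 hr rfl
  obtain ⟨x2, y2⟩ := Q_minor hRC ih hi hj2 a2 hr rfl
  obtain ⟨x3, y3⟩ := Q_minor hRC ih hi hj3 a3 hr rfl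
  obtain ⟨f1, f2, -⟩ := psi_facts (Nn A R C)
  have hle : ∀ c : ℕ, 3 ≤ c → ψ (Nn A R C - 6 + (3:ℕ) + c) ≤ ψ (Nn A R C) :=
    fun c hc => psi_anti (by push_cast; omega)
  have heq : ∀ c : ℕ, 3 ≤ c → ψ (Nn A R C - 6 + (3:ℕ) + c) = ψ (Nn A R C) →
      c = 3 ∨ (c = 4 ∧ (Nn A R C % 6 = 3 ∨ Nn A R C % 6 = 5)) := by
    intro c hc he
    by_cases h3 : c = 3
    · exact Or.inl h3
    by_cases h4 : c = 4
    · subst h4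
      refine Or.inr ⟨rfl, f1 ?_⟩
      rw [← he]
      congr 1
      push_cast
      ring
    · exfalso
      have : ψ (Nn A R C - 6 + (3:ℕ) + c) ≤ ψ (Nn A R C + 2) := psi_anti (by push_cast; omega)
      linarith
  have c1 := hmin j1 hj1
  have c2 := hmin j2 hj2
  have c3 := hmin j3 hj3
  have l1 := hle _ c1
  have l2 := hle _ c2
  have l3 := hle _ c3
  have t1 := heq _ c1
  have t2 := heq _ c2
  have t3 := heq _ c3
  by_cases hE : Qn A R C = ψ (Nn A R C)
  swap
  · rw [good_iff]
    exact ⟨by linarith, fun h => absurd h hE⟩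
  have t1 := t1 (by linarith)
  have t2 := t2 (by linarith)
  have t3 := t3 (by linarith)
  have y1 := y1 (by linarith)
  have y2 := y2 (by linarith)
  have y3 := y3 (by linarith)
  have hcase : Nn A R C % 6 = 2 ∨ Nn A R C % 6 = 3 ∨
     (Nn A R C % 6 = 0 ∨ Nn A R C % 6 = 1 ∨ Nn A R C % 6 = 4 ∨ Nn A R C % 6 = 5) := by omega
  rcases hcase with hq | hq | hq
  · rw [good_iff]; exact ⟨hE.le, fun _ => Ext_trivial (Or.inl hq)⟩
  · rw [good_iff]; exact ⟨hE.le, fun _ => Ext_trivial (Or.inr hq)⟩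
  have d1 := cd_erase A hi a1
  have d2 := cd_erase A hi a2
  have d3 := cd_erase A hi a3
  have hJ : ∀ c : ℕ, c = 4 → Nn A R C % 6 = 5 → (Nn A R C - 6 + (3:ℕ) + c) % 6 = 0 := by
    intro c hc h5
    rw [hc]
    push_cast
    omega
  by_cases hall : cd A R j1 = 3 ∧ cd A R j2 = 3 ∧ cd A R j3 = 3
  · obtain ⟨k1, k2, k3⟩ := hall
    have e : Nn A R C - 6 + (3:ℕ) + (3:ℕ) = Nn A R C := by push_cast; ring
    rw [k1, e] at y1
    rw [k2, e] at y2
    have hoth : ∀ j ∈ C, j ≠ j1 → j ≠ j2 → j ≠ j3 → 3 ≤ cd A (R.erase i) j := by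
      intro j hj n1 n2 n3
      rw [cd_erase' A (by rw [hrow j hj]; exact fun h => h.elim n1 (fun h => h.elim n2 n3))]
      exact hmin j hj
    have w1 := twin hq y1 h23 (by simp [hj2, h12.symm]) (by simp [hj3, h13.symm])
      (by omega) (by omega) (fun j hj n2 n3 => by
        rw [Finset.mem_erase] at hj
        exact hoth j hj.2 hj.1 n2 n3)
    have w2 := twin hq y2 h13 (by simp [hj1, h12]) (by simp [hj3, h23.symm])
      (by omega) (by omega) (fun j hj n2 n3 => by
        rw [Finset.mem_erase] at hj
        exact hoth j hj.2 n2 hj.1 n3)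
    have hCB : ColB A R C (R.filter (fun k => A k j1)) {j1, j2, j3} := by
      refine ⟨Finset.filter_subset _ _, ?_, ?_, ?_⟩
      · rw [← hf]; exact Finset.filter_subset _ _
      · rw [← hf]
        exact k1.trans hr.symm
      · intro k hk j hj
        rw [Finset.mem_filter]
        by_cases hki : k = i
        · subst hki
          have : A k j := by
            rw [← hf, Finset.mem_filter] at hj
            exact hj.2
          simp [hi, a1, this]
        · have hk' : k ∈ R.erase i := Finset.mem_erase.2 ⟨hki, hk⟩
          have u1 := w1 k hk'
          have u2 := w2 k hk'
          simp only [Finset.mem_insert, Finset.mem_singleton] at hj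
          rcases hj with rfl | rfl | rfl
          · simp [hk]
          · simp [hk, u1, u2]
          · simp [hk, u2]
    have g1 := Finset.card_sdiff_add_card_eq_card hCB.1
    have g2 := Finset.card_sdiff_add_card_eq_card hCB.2.1
    have g3 := hCB.2.2.1
    have g4 : ({j1, j2, j3} : Finset β).card = 3 := by rw [← hf]; exact hr
    exact reduceCol hCB (Or.inr g4) (ih _ _ _ (by omega) (by omega))
  · have h5 : Nn A R C % 6 = 5 := by omega
    have fin : Good A R C ∨ EH 4 A R C := by
      by_cases k1 : cd A R j1 = 4
      · exact case3five hRC ih hi h12 h13 h23 hj1 hj2 hj3 hrow hminR hmin k1 (by omega) (by omega)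
          (y1.1 (hJ _ k1 h5)) (fun k => y2.1 (hJ _ k h5)) (fun k => y3.1 (hJ _ k h5))
      by_cases k2 : cd A R j2 = 4
      · exact case3five hRC ih hi h12.symm h23 h13 hj2 hj1 hj3
          (fun j hj => by rw [hrow j hj]; exact or_left_comm) hminR hmin k2 (by omega) (by omega)
          (y2.1 (hJ _ k2 h5)) (fun k => y1.1 (hJ _ k h5)) (fun k => y3.1 (hJ _ k h5))
      · have k3 : cd A R j3 = 4 := by omega
        exact case3five hRC ih hi h13.symm h23.symm h12 hj3 hj1 hj2
          (fun j hj => by rw [hrow j hj, or_left_comm, ← or_assoc, or_comm, or_comm (a := j = j2)]) hminR hmin k3 (by omega) (by omega)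
          (y3.1 (hJ _ k3 h5)) (fun k => y1.1 (hJ _ k h5)) (fun k => y2.1 (hJ _ k h5))
    rcases fin with h | h
    · exact h
    · rw [good_iff]
      exact ⟨hE.le, fun _ => ⟨fun _ => by omega, fun _ => by omega, fun _ => by omega,
        fun _ => Or.inr (Or.inl h)⟩⟩

theorem rowStep {A : α → β → Prop} {R : Finset α} {C : Finset β} (hRC : R.card = C.card)
    (ih : IHp α β R.card) {i : α} (hi : i ∈ R)
    (hminR : ∀ k ∈ R, rd A C i ≤ rd A C k) (hmin : ∀ j ∈ C, rd A C i ≤ cd A R j) :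
    Good A R C := by
  rcases Nat.lt_or_ge (rd A C i) 4 with h | h
  · have : rd A C i = 0 ∨ rd A C i = 1 ∨ rd A C i = 2 ∨ rd A C i = 3 := by omega
    rcases this with h | h | h | h
    · exact case0 hi h
    · exact case1 hRC ih hi h
    · rw [h] at hminR hmin
      exact case2 hRC ih hi h hminR hmin
    · rw [h] at hminR hmin
      exact case3 hRC ih hi h hminR hmin
  · exact case4 hRC ih hi h hmin

theorem good_main (n : ℕ) : IHp α β n := by
  induction n with
  | zero => intro B R C _ h; omega
  | succ n ih =>
    intro A R C hRC hlt
    by_cases hn : R.card < n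
    · exact ih A R C hRC hn
    have hn : R.card = n := by omega
    rw [← hn] at ih
    rcases R.eq_empty_or_nonempty with rfl | hR
    · have : C = ∅ := by rw [← Finset.card_eq_zero, ← hRC]; rfl
      subst this
      have hN : Nn A ∅ ∅ = 0 := by simp [Nn, sg]
      unfold Good
      rw [hN]
      refine ⟨by simp [P_empty, psi_vals.1], fun _ => ⟨fun _ => JS_empty A, ?_, ?_, ?_⟩⟩ <;>
        intro h <;> norm_num at h
    · have hC : C.Nonempty := by
        rw [← Finset.card_pos, ← hRC, Finset.card_pos]; exact hR
      obtain ⟨i, hi, him⟩ := Finset.exists_min_image R (rd A C) hR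
      obtain ⟨j, hj, hjm⟩ := Finset.exists_min_image C (cd A R) hC
      by_cases hle : rd A C i ≤ cd A R j
      · exact rowStep hRC ih hi him (fun j' hj' => hle.trans (hjm j' hj'))
      · apply Good_tr hRC
        have hle : cd A R j ≤ rd A C i := by omega
        exact rowStep (A := tr A) hRC.symm (by rw [← hRC]; exact IHp_tr ih) hj hjm
          (fun k hk => hle.trans (him k hk))

theorem good_all (A : α → β → Prop) (R : Finset α) (C : Finset β) (h : R.card = C.card) :
    Good A R C := good_main (R.card + 1) A R C h (by omega)

end stepthree

section values
open scoped Classical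
set_option linter.unusedSectionVars false
set_option linter.unusedSimpArgs false
set_option linter.unusedVariables false

variable {α β : Type} [DecidableEq α] [DecidableEq β]

theorem psi_rel (N : ℤ) : (N % 6 = 5 → ψ (N + 1) = ψ N ∧ ψ (N - 4) = 3 * ψ N) ∧
    (N % 6 = 1 → 2 * ψ (N - 1) = 3 * ψ N) := by
  obtain ⟨t, x, hx, h0, h6, ht, hc⟩ := psi_decomp N
  have e0 := hc 0
  rw [add_zero] at e0
  have m1 := hc (-1)
  have m4 := hc (-4)
  simp only [← sub_eq_add_neg] at m1 m4
  rw [hc 1, e0, m1, m4, ht]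
  obtain ⟨v0, v1, v2, v3, v4, v5, v6, v7, v8, v9, v10, v11, v12, v13, w1, w2, w3, w4⟩ := psi_vals
  constructor
  · rintro rfl
    norm_num [v1, v5, v6]
    ring
  · rintro rfl
    norm_num [v0, v1]
    ring

theorem JS_value (n : ℕ) : ∀ (A : α → β → Prop) (R : Finset α) (C : Finset β), R.card = n →
    C.card = n → JS A R C → Qn A R C = ψ (Nn A R C) ∧ Nn A R C % 6 = 0 := by
  induction n using Nat.strong_induction_on with
  | _ n ih =>
    intro A R C hR hC hJ
    rcases R.eq_empty_or_nonempty with rfl | hne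
    · have : C = ∅ := by rw [← Finset.card_eq_zero, hC, ← hR]; rfl
      subst this
      have hN : Nn A ∅ ∅ = 0 := by simp [Nn, sg]
      rw [hN]
      simp [Qn, P_empty, psi_vals.1]
    · obtain ⟨i, hi⟩ := hne
      obtain ⟨S, T, hb, -⟩ := hJ.1 i hi
      have hJ' := JS_rem hb hJ
      obtain ⟨b1, b2, b3, b4, b5⟩ := hb
      have hCB : ColB A R C S T := by
        refine ⟨b1, b2, b3, fun k hk j hj => ?_⟩
        have := b5 k hk j (b2 hj) (Or.inr hj)
        rw [this]
        simp [hj]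
      have hsg := sg_colB hCB
      have hP := P_colB A T.card R C S T rfl hCB
      have hz : sg A S (C \ T) = 0 := by
        rw [sg_zero]
        intro k hk j hj
        rw [Finset.mem_sdiff] at hj
        rw [b5 k (b1 hk) j hj.1 (Or.inl hk)]
        tauto
      have d1 := Finset.card_sdiff_add_card_eq_card b1
      have d2 := Finset.card_sdiff_add_card_eq_card b2
      obtain ⟨v1, v2⟩ := ih (R \ S).card (by omega) A (R \ S) (C \ T) rfl (by omega) hJ'
      have hN : Nn A (R \ S) (C \ T) = Nn A R C - 6 := by
        unfold Nn
        rw [hsg, hz, ← d1, b3]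
        push_cast
        rcases b4 with h | h <;> rw [h] <;> push_cast <;> ring
      rw [hN] at v1 v2
      rw [psi_six] at v1
      refine ⟨?_, by omega⟩
      have : Qn A R C = 2 / 9 * Qn A (R \ S) (C \ T) := by
        unfold Qn
        rw [hP, ← d1, b3, pow_add]
        rcases b4 with h | h <;> rw [h] <;> push_cast [Nat.factorial] <;> field_simp <;> ring_nf
      rw [this, v1]
      ring

theorem EH_value {k : ℕ} (hk : k = 3 ∨ k = 4) {A : α → β → Prop} {R : Finset α} {C : Finset β}
    (hRC : R.card = C.card) (h : EH k A R C) :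
    (Nn A R C - 7 + 2 * k) % 6 = 0 ∧ 3 * Qn A R C = (k - 1) * ψ (Nn A R C - 7 + 2 * k) := by
  obtain ⟨S, T, ⟨s1, s2, s3⟩, ⟨c1, c2, i0, hi0, j0, hj0, hh⟩, hJ⟩ := h
  have hi := s1 hi0
  have hfr : C.filter (A i0) = T.erase j0 := by
    ext j
    have a1 := s3 i0 hi j
    have a2 := hh i0 hi0 j
    have a3 := @s2 j
    simp only [Finset.mem_filter, Finset.mem_erase]
    grind
  have hfc : ∀ j ∈ T, j ≠ j0 → R.filter (fun k => A k j) = S := by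
    intro j hj hne
    ext i
    have a1 := s3 i
    have a2 := hh i
    have a3 := @s1 i
    have a4 := @s2 j
    simp only [Finset.mem_filter]
    grind
  have hce : (T.erase j0).card = k - 1 := by rw [Finset.card_erase_of_mem hj0, c2]
  have hr : rd A C i0 = k - 1 := by rw [rd, hfr, hce]
  have hm : ∀ j ∈ T.erase j0, Qn A (R.erase i0) (C.erase j) = ψ (Nn A R C - 7 + 2 * k) ∧
      (Nn A R C - 7 + 2 * k) % 6 = 0 := by
    intro j hj
    rw [Finset.mem_erase] at hj
    have hjC := s2 hj.2
    have hA : A i0 j := (hh i0 hi0 j hj.2).2 (by tauto)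
    have hc : cd A R j = k := by rw [cd, hfc j hj.2 hj.1, c1]
    have hN := Nn_minor A hi hjC hA
    rw [hr, hc] at hN
    have hN' : Nn A (R.erase i0) (C.erase j) = Nn A R C - 7 + 2 * k := by
      rw [hN]; omega
    rw [← hN']
    have e1 := Finset.card_erase_add_one hi
    have e2 := Finset.card_erase_add_one hjC
    refine JS_value (R.erase i0).card A _ _ rfl (by omega) ?_
    have e3 := Finset.card_erase_add_one hi0
    have e4 := Finset.card_erase_add_one hj.2
    refine JS_add (S := S.erase i0) (T := T.erase j)
      ⟨Finset.erase_subset_erase _ s1, Finset.erase_subset_erase _ s2, by omega, by omega, ?_⟩ ?_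
    · intro i hi' l hl hor
      have a1 := s3 i
      have a2 := hh i
      have a3 := @s1 i
      have a4 := @s2 l
      simp only [Finset.mem_erase] at *
      grind
    · have f1 : R.erase i0 \ S.erase i0 = R \ S := by
        ext x; simp only [Finset.mem_sdiff, Finset.mem_erase]; grind
      have f2 : C.erase j \ T.erase j = C \ T := by
        ext x; simp only [Finset.mem_sdiff, Finset.mem_erase]; grind
      rw [f1, f2]
      exact hJ
  have hQ := Qn_row A C hi
  rw [hfr, Finset.sum_congr rfl (fun j hj => (hm j hj).1), Finset.sum_const, hce,
    nsmul_eq_mul] at hQ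
  obtain ⟨j, hj⟩ : (T.erase j0).Nonempty := by rw [← Finset.card_pos]; omega
  refine ⟨(hm j hj).2, ?_⟩
  rw [hQ, Nat.cast_sub (by omega)]
  norm_num

theorem Ext5_value {A : α → β → Prop} {R : Finset α} {C : Finset β}
    (hRC : R.card = C.card) (h : ET A R C ∨ EH 4 A R C ∨ EP A R C) :
    Qn A R C = ψ (Nn A R C) := by
  rcases h with h | h | h
  · obtain ⟨i, j, ⟨hi, hj, hiso⟩, hE⟩ := h
    have e1 := Finset.card_erase_add_one hi
    have e2 := Finset.card_erase_add_one hj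
    have hA : A i j := (hiso i hi j hj (Or.inl rfl)).2 ⟨rfl, rfl⟩
    have hf : C.filter (A i) = {j} := by
      ext x
      have := hiso i hi x
      simp only [Finset.mem_filter, Finset.mem_singleton]
      grind
    have hc : cd A R j = 1 := Iso1_cd ⟨hi, hj, hiso⟩
    have hr : rd A C i = 1 := by rw [rd, hf]; rfl
    have hN := Nn_minor A hi hj hA
    obtain ⟨v1, v2⟩ := EH_value (Or.inl rfl) (by omega) hE
    have hQ := Qn_row A C hi
    rw [hf, Finset.sum_singleton] at hQ
    rw [hr, hc] at hN
    have hN : Nn A (R.erase i) (C.erase j) = Nn A R C - 4 := by rw [hN]; push_cast; ring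
    rw [hN] at v1 v2
    push_cast at v1 v2
    have r1 := ((psi_rel (Nn A R C)).1 (by omega)).2
    have r2 := (psi_rel (Nn A R C - 4)).2 (by omega)
    have e : Nn A R C - 4 - 7 + 6 = Nn A R C - 4 - 1 := by ring
    rw [e] at v2
    linarith
  · obtain ⟨v1, v2⟩ := EH_value (Or.inr rfl) hRC h
    push_cast at v1 v2
    have r1 := ((psi_rel (Nn A R C)).1 (by omega)).1
    have e : Nn A R C - 7 + 8 = Nn A R C + 1 := by ring
    rw [e] at v2
    linarith
  · obtain ⟨i0, hi0, j0, hj0, ha, hJ⟩ := h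
    obtain ⟨v1, v2⟩ := JS_value R.card (delOne A i0 j0) R C rfl hRC.symm hJ
    have hs := sg_delOne hi0 hj0 ha
    have hN : Nn (delOne A i0 j0) R C = Nn A R C + 1 := by
      unfold Nn; rw [hs]; push_cast; ring
    rw [hN] at v1 v2
    have r1 := ((psi_rel (Nn A R C)).1 (by omega)).1
    apply le_antisymm (good_iff.1 (good_all A R C hRC)).1
    rw [← r1, ← v1]
    unfold Qn
    have : P (delOne A i0 j0) R C ≤ P A R C := P_mono (fun i _ j _ h => h.1)
    gcongr

theorem five_main {A : α → β → Prop} {R : Finset α} {C : Finset β}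
    (hRC : R.card = C.card) (h5 : Nn A R C % 6 = 5) :
    (P A R C : ℚ) ≤ 3 ^ R.card * ψ (Nn A R C) ∧
    ((P A R C : ℚ) = 3 ^ R.card * ψ (Nn A R C) ↔ (ET A R C ∨ EH 4 A R C ∨ EP A R C)) := by
  have g := good_all A R C hRC
  refine ⟨g.1, fun h => (g.2 h).2.2.2 h5, fun h => ?_⟩
  have := Ext5_value hRC h
  unfold Qn at this
  rw [← this]
  field_simp

end values

section bridge
open scoped Classical
set_option linter.unusedSectionVars false
set_option linter.unusedSimpArgs false
set_option linter.unusedVariables false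

/-- support relation of a matrix -/
def rel {n : ℕ} (M : Matrix (Fin n) (Fin n) ℕ) : Fin n → Fin n → Prop := fun i j => M i j = 1

theorem perm_eq_P {n : ℕ} {M : Matrix (Fin n) (Fin n) ℕ} (h : IsZeroOne M) :
    perm M = P (rel M) Finset.univ Finset.univ := by
  have h1 : perm M = (Finset.univ.filter
      (fun φ : Equiv.Perm (Fin n) => ∀ i, M i (φ i) = 1)).card := by
    unfold perm
    rw [Finset.card_filter]
    apply Finset.sum_congr rfl
    intro φ _
    split_ifs with hh
    · exact Finset.prod_eq_one fun i _ => hh i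
    · push Not at hh
      obtain ⟨i, hi⟩ := hh
      apply Finset.prod_eq_zero (Finset.mem_univ i)
      rcases h i (φ i) with h | h
      · exact h
      · exact absurd h hi
  rw [h1, P]
  refine Finset.card_bij (fun φ _ => Finset.univ.image (fun i => (i, φ i))) ?_ ?_ ?_
  · intro φ hφ
    rw [Finset.mem_filter] at hφ
    rw [mem_PM]
    refine ⟨?_, ?_, ?_, ?_, ?_⟩
    · intro i j hij
      simp only [Finset.mem_image, Finset.mem_univ, true_and, Prod.mk.injEq] at hij
      obtain ⟨k, rfl, rfl⟩ := hij
      exact ⟨Finset.mem_univ _, Finset.mem_univ _, hφ.2 _⟩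
    · intro i _
      exact ⟨φ i, by simp⟩
    · intro j _
      exact ⟨φ.symm j, by simp⟩
    · intro i j j' h1 h2
      simp only [Finset.mem_image, Finset.mem_univ, true_and, Prod.mk.injEq] at h1 h2
      grind
    · intro i i' j h1 h2
      simp only [Finset.mem_image, Finset.mem_univ, true_and, Prod.mk.injEq] at h1 h2
      obtain ⟨k, rfl, rfl⟩ := h1
      obtain ⟨k', rfl, e⟩ := h2
      exact (φ.injective e).symm
  · intro φ _ φ' _ he
    ext i
    have : (i, φ i) ∈ Finset.univ.image (fun i => (i, φ' i)) := by
      rw [← he]; simp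
    simp only [Finset.mem_image, Finset.mem_univ, true_and, Prod.mk.injEq] at this
    obtain ⟨k, rfl, e⟩ := this
    rw [e]
  · intro X hX
    rw [mem_PM] at hX
    obtain ⟨x1, x2, x3, x4, x5⟩ := hX
    choose f hf using fun i => x2 i (Finset.mem_univ i)
    have hinj : Function.Injective f := by
      intro i i' e
      have h1 := hf i
      have h2 := hf i'
      rw [← e] at h2
      exact x5 _ _ _ h1 h2
    have hbij := Finite.injective_iff_bijective.1 hinj
    refine ⟨Equiv.ofBijective f hbij, ?_, ?_⟩
    · rw [Finset.mem_filter]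
      exact ⟨Finset.mem_univ _, fun i => (x1 _ _ (hf i)).2.2⟩
    · ext ⟨i, j⟩
      simp only [Finset.mem_image, Finset.mem_univ, true_and, Prod.mk.injEq,
        Equiv.ofBijective_apply]
      constructor
      · rintro ⟨k, rfl, rfl⟩
        exact hf k
      · intro hij
        exact ⟨i, rfl, x4 _ _ _ (hf i) hij⟩

theorem sg_zeroCount {n : ℕ} {M : Matrix (Fin n) (Fin n) ℕ} (h : IsZeroOne M) :
    sg (rel M) Finset.univ Finset.univ + zeroCount M = n ^ 2 := by
  have h1 : sg (rel M) Finset.univ Finset.univ =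
      (Finset.univ.filter fun p : Fin n × Fin n => ¬ M p.1 p.2 = 0).card := by
    unfold sg rd rel
    rw [Finset.card_filter, Fintype.sum_prod_type]
    apply Finset.sum_congr rfl
    intro i _
    rw [Finset.card_filter]
    apply Finset.sum_congr rfl
    intro j _
    rcases h i j with h | h <;> simp [h]
  rw [h1, zeroCount, add_comm]
  have := Finset.card_filter_add_card_filter_not (s := (Finset.univ : Finset (Fin n × Fin n)))
    (fun p => M p.1 p.2 = 0)
  rw [Finset.card_univ, Fintype.card_prod, Fintype.card_fin] at this
  rw [sq, ← this]

/-- reindexing of rows and columns -/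
def REq {n : ℕ} (A B : Matrix (Fin n) (Fin n) ℕ) : Prop :=
  ∃ e f : Equiv.Perm (Fin n), ∀ i j, B i j = A (e i) (f j)

theorem perm_mul_apply {n : ℕ} {A P Q : Matrix (Fin n) (Fin n) ℕ} {e f : Equiv.Perm (Fin n)}
    (hP : ∀ i j, P i j = if j = e i then 1 else 0) (hQ : ∀ i j, Q i j = if j = f i then 1 else 0)
    (i j : Fin n) : (P * A * Q) i j = A (e i) (f.symm j) := by
  rw [Matrix.mul_apply]
  have h1 : ∀ k, (P * A) i k = A (e i) k := by
    intro k
    rw [Matrix.mul_apply, Finset.sum_eq_single (e i)]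
    · simp [hP]
    · intro b _ hb
      simp [hP, hb]
    · simp
  rw [Finset.sum_eq_single (f.symm j)]
  · simp [h1, hQ]
  · intro b _ hb
    have : j ≠ f b := fun hh => hb (by rw [hh]; simp)
    simp [hQ, this]
  · simp

theorem CombEquiv_of_REq {n : ℕ} {A B : Matrix (Fin n) (Fin n) ℕ} (h : REq A B) :
    CombEquiv A B := by
  obtain ⟨e, f, hef⟩ := h
  refine ⟨Matrix.of fun i j => if j = e i then 1 else 0,
    Matrix.of fun i j => if j = f.symm i then 1 else 0, ⟨e, fun _ _ => rfl⟩,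
    ⟨f.symm, fun _ _ => rfl⟩, Or.inl ?_⟩
  ext i j
  have := perm_mul_apply (A := A) (P := Matrix.of fun i j => if j = e i then 1 else 0)
    (Q := Matrix.of fun i j => if j = f.symm i then 1 else 0) (e := e) (f := f.symm)
    (fun _ _ => rfl) (fun _ _ => rfl) i j
  rw [this]
  exact hef i j

theorem REq_of_CombEquiv {n : ℕ} {A B : Matrix (Fin n) (Fin n) ℕ} (h : CombEquiv A B) :
    REq A B ∨ REq A.transpose B := by
  obtain ⟨P, Q, ⟨e, he⟩, ⟨f, hf⟩, h | h⟩ := h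
  · left
    refine ⟨e, f.symm, fun i j => ?_⟩
    rw [h, perm_mul_apply he hf]
  · right
    refine ⟨e, f.symm, fun i j => ?_⟩
    rw [h, perm_mul_apply he hf]

theorem perm_REq {n : ℕ} {A B : Matrix (Fin n) (Fin n) ℕ} (h : REq A B) : perm B = perm A := by
  obtain ⟨e, f, hef⟩ := h
  unfold perm
  refine Fintype.sum_equiv ((Equiv.mulLeft f).trans (Equiv.mulRight e⁻¹)) _ _ fun φ => ?_
  refine Fintype.prod_equiv e _ _ fun i => ?_
  rw [hef]
  simp

theorem perm_transpose {n : ℕ} (A : Matrix (Fin n) (Fin n) ℕ) : perm A.transpose = perm A := by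
  unfold perm
  refine Fintype.sum_equiv (Equiv.inv _) _ _ fun φ => ?_
  refine Fintype.prod_equiv φ _ _ fun i => ?_
  simp

theorem perm_CombEquiv {n : ℕ} {A B : Matrix (Fin n) (Fin n) ℕ} (h : CombEquiv A B) :
    perm B = perm A := by
  rcases REq_of_CombEquiv h with h | h
  · exact perm_REq h
  · rw [perm_REq h, perm_transpose]

theorem Uclass_REq {n τ : ℕ} {A B : Matrix (Fin n) (Fin n) ℕ} (h : REq A B) (hA : A ∈ Uclass n τ) :
    B ∈ Uclass n τ := by
  obtain ⟨e, f, hef⟩ := h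
  obtain ⟨h1, h2⟩ := hA
  refine ⟨fun i j => by rw [hef]; exact h1 _ _, ?_⟩
  rw [← h2]
  unfold zeroCount
  refine Finset.card_equiv (Equiv.prodCongr e f) ?_
  rintro ⟨i, j⟩
  simp [hef]

theorem setOne_class {n : ℕ} {M : Matrix (Fin n) (Fin n) ℕ} {i0 j0 : Fin n} (hM : IsZeroOne M)
    (h0 : M i0 j0 = 0) : IsZeroOne (setOne M i0 j0) ∧
      zeroCount M = zeroCount (setOne M i0 j0) + 1 ∧
      rel (setOne M i0 j0) = addOne (rel M) i0 j0 := by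
  have hz : IsZeroOne (setOne M i0 j0) := by
    intro i j
    simp only [setOne, Matrix.of_apply]
    split_ifs
    · exact Or.inr rfl
    · exact hM i j
  have hr : rel (setOne M i0 j0) = addOne (rel M) i0 j0 := by
    funext i j
    simp only [rel, setOne, Matrix.of_apply, addOne, eq_iff_iff]
    split_ifs with h
    · simp [h]
    · simp [h]
  refine ⟨hz, ?_, hr⟩
  have h1 := sg_zeroCount hM
  have h2 := sg_zeroCount hz
  rw [hr, sg_addOne (rel M) (Finset.mem_univ _) (Finset.mem_univ _) (by simp [rel, h0])] at h2
  omega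

/-- the bound and the characterization, in relation form -/
theorem matrix_main {n τ σ k m : ℕ} (hσ : σ + τ = n ^ 2) (hn : n = 3 * k + 2 * m + 2)
    (hs : σ = 9 * k + 4 * m + 5) {M : Matrix (Fin n) (Fin n) ℕ} (hM : M ∈ Uclass n τ) :
    perm M ≤ 2 * 6 ^ k * 2 ^ m ∧ (perm M = 2 * 6 ^ k * 2 ^ m ↔
      (ET (rel M) Finset.univ Finset.univ ∨ EH 4 (rel M) Finset.univ Finset.univ ∨
        EP (rel M) Finset.univ Finset.univ)) := by
  have hsg := sg_zeroCount hM.1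
  rw [hM.2] at hsg
  have hN : Nn (rel M) Finset.univ Finset.univ = 6 * ((k : ℤ) + m) + 5 := by
    unfold Nn
    rw [Finset.card_univ, Fintype.card_fin]
    omega
  have h5 := five_main (A := rel M) (R := Finset.univ) (C := Finset.univ) rfl (by omega)
  have hb : (3 : ℚ) ^ (Finset.univ : Finset (Fin n)).card * ψ (Nn (rel M) Finset.univ Finset.univ) =
      ((2 * 6 ^ k * 2 ^ m : ℕ) : ℚ) := by
    rw [hN, psi_shift, Finset.card_univ, Fintype.card_fin, psi_vals.2.2.2.2.2.1, hn]
    have : ((2 / 9 : ℚ)) ^ ((k : ℤ) + m) = (2/9) ^ k * (2/9) ^ m := by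
      rw [zpow_add₀ (by norm_num), zpow_natCast, zpow_natCast]
    rw [this]
    push_cast
    rw [pow_add, pow_add, pow_mul, pow_mul, show (6 : ℚ) = 3 ^ 3 * (2 / 9) by norm_num,
      mul_pow, show (2 : ℚ) ^ m = (3 ^ 2 * (2 / 9)) ^ m by norm_num, mul_pow]
    ring
  rw [hb, ← perm_eq_P hM.1] at h5
  exact_mod_cast h5

end bridge

theorem T4_apply (x y : ℕ) (hx : x < 4) (hy : y < 4) :
    T4 ⟨x, hx⟩ ⟨y, hy⟩ = 1 ↔ (x < 3 ∧ y < 3 ∧ ¬ (x = 0 ∧ y = 0)) ∨ (x = 3 ∧ y = 3) := by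
  have h : ∀ u v : Fin 4, T4 u v = 1 ↔
      (u.val < 3 ∧ v.val < 3 ∧ ¬ (u.val = 0 ∧ v.val = 0)) ∨ (u.val = 3 ∧ v.val = 3) := by
    intro u v
    fin_cases u <;> fin_cases v <;> simp [T4, Q6]
  exact h ⟨x, hx⟩ ⟨y, hy⟩

theorem Q6_apply (x y : ℕ) (hx : x < 6) (hy : y < 6) :
    Q6 ⟨x, hx⟩ ⟨y, hy⟩ = 1 ↔ (x < 4 ∧ y < 4 ∧ ¬ (x = 0 ∧ y = 0)) ∨ (4 ≤ x ∧ 4 ≤ y) := by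
  have h : ∀ u v : Fin 6, Q6 u v = 1 ↔
      (u.val < 4 ∧ v.val < 4 ∧ ¬ (u.val = 0 ∧ v.val = 0)) ∨ (4 ≤ u.val ∧ 4 ≤ v.val) := by
    intro u v
    fin_cases u <;> fin_cases v <;> simp [T4, Q6]
  exact h ⟨x, hx⟩ ⟨y, hy⟩

section concrete
open scoped Classical
set_option linter.unusedSectionVars false
set_option linter.unusedSimpArgs false
set_option linter.unusedVariables false

/-- indices at least `m` -/
def Rm (n m : ℕ) : Finset (Fin n) := Finset.univ.filter (fun i => m ≤ i.val)

/-- indices in `[m, m+s)` -/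
def Sm (n m s : ℕ) : Finset (Fin n) := Finset.univ.filter (fun i => m ≤ i.val ∧ i.val < m + s)

theorem Rm_sdiff (n m s : ℕ) : Rm n m \ Sm n m s = Rm n (m + s) := by
  ext i
  simp only [Rm, Sm, Finset.mem_sdiff, Finset.mem_filter, Finset.mem_univ, true_and]
  omega

theorem Rm_zero (n : ℕ) : Rm n 0 = Finset.univ := by
  ext i; simp [Rm]

theorem Sm_card {n m s : ℕ} (h : m + s ≤ n) : (Sm n m s).card = s := by
  have : (Sm n m s).card = (Finset.Ico m (m + s)).card := by
    refine Finset.card_bij (fun i _ => i.val) ?_ ?_ ?_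
    · intro i hi
      simpa [Sm] using hi
    · intro i _ j _ h
      exact Fin.ext h
    · intro b hb
      rw [Finset.mem_Ico] at hb
      exact ⟨⟨b, by omega⟩, by simp [Sm, hb], rfl⟩
  rw [this]; simp

theorem concrete_block {n m s : ℕ} {L : List ℕ} {A : Fin n → Fin n → Prop} (hs : s = 2 ∨ s = 3)
    (hn : m + s ≤ n)
    (hA : ∀ i j : Fin n, m ≤ i.val → m ≤ j.val →
      (A i j ↔ blockIdx (s :: L) (i - m) = blockIdx (s :: L) (j - m))) :
    Block A (Rm n m) (Rm n m) (Sm n m s) (Sm n m s) := by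
  refine ⟨?_, ?_, rfl, ?_, ?_⟩
  · intro i; simp only [Rm, Sm, Finset.mem_filter, Finset.mem_univ, true_and]; omega
  · intro i; simp only [Rm, Sm, Finset.mem_filter, Finset.mem_univ, true_and]; omega
  · rw [Sm_card hn]; exact hs
  · intro i hi j hj
    simp only [Rm, Sm, Finset.mem_filter, Finset.mem_univ, true_and] at *
    rw [hA i j hi hj]
    simp only [blockIdx]
    intro h
    split_ifs with h1 h2 h2
    · simp only [true_iff]; omega
    · constructor
      · intro h; exact h.elim
      · intro h; omega
    · constructor
      · intro h; exact h.elim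
      · intro h; omega
    · omega

theorem concrete_JS {n : ℕ} {A : Fin n → Fin n → Prop} (L : List ℕ) : ∀ (m : ℕ),
    (∀ s ∈ L, s = 2 ∨ s = 3) → m + L.sum = n →
    (∀ i j : Fin n, m ≤ i.val → m ≤ j.val →
      (A i j ↔ blockIdx L (i - m) = blockIdx L (j - m))) →
    JS A (Rm n m) (Rm n m) ∧ sg A (Rm n m) (Rm n m) = (L.map (fun s => s * s)).sum := by
  induction L with
  | nil =>
    intro m _ hm _
    have : Rm n m = ∅ := by
      ext i
      have := i.2
      simp only [List.sum_nil] at hm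
      simp only [Rm, Finset.mem_filter, Finset.mem_univ, true_and, Finset.notMem_empty, iff_false]
      omega
    rw [this]
    exact ⟨JS_empty _, by simp [sg]⟩
  | cons s L ih =>
    intro m hL hm hA
    have hs := hL s (by simp)
    rw [List.sum_cons] at hm
    have hb := concrete_block hs (by omega) hA
    have ih' := ih (m + s) (fun t ht => hL t (by simp [ht])) (by omega) (by
      intro i j hi hj
      rw [hA i j (by omega) (by omega)]
      simp only [blockIdx]
      rw [if_neg (by omega), if_neg (by omega), Nat.sub_sub, Nat.sub_sub]
      omega)
    rw [← Rm_sdiff] at ih'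
    refine ⟨JS_add hb ih'.1, ?_⟩
    have hc : ColB A (Rm n m) (Rm n m) (Sm n m s) (Sm n m s) := by
      refine ⟨hb.1, hb.2.1, rfl, fun i hi j hj => ?_⟩
      rw [hb.2.2.2.2 i hi j (hb.2.1 hj) (Or.inr hj)]
      simp [hj]
    have h0 : sg A (Sm n m s) (Rm n m \ Sm n m s) = 0 := by
      rw [sg_zero]
      intro i hi j hj
      rw [Finset.mem_sdiff] at hj
      rw [hb.2.2.2.2 i (hb.1 hi) j hj.1 (Or.inl hi)]
      simp [hj.2]
    rw [sg_colB hc, h0, ih'.2, Sm_card (by omega)]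
    simp

theorem rep_mem {a c s : ℕ} (h : s ∈ List.replicate a 3 ++ List.replicate c 2) :
    s = 2 ∨ s = 3 := by
  rw [List.mem_append, List.mem_replicate, List.mem_replicate] at h
  tauto

theorem list_JS {n a c : ℕ} (h : 3 * a + 2 * c = n) :
    IsZeroOne (listBlocks n (List.replicate a 3 ++ List.replicate c 2)) ∧
    JS (rel (listBlocks n (List.replicate a 3 ++ List.replicate c 2))) Finset.univ Finset.univ ∧
    sg (rel (listBlocks n (List.replicate a 3 ++ List.replicate c 2))) Finset.univ Finset.univ
      = 9 * a + 4 * c := by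
  refine ⟨fun i j => ?_, ?_⟩
  · simp only [listBlocks, Matrix.of_apply]
    split_ifs <;> simp
  · have := concrete_JS (A := rel (listBlocks n (List.replicate a 3 ++ List.replicate c 2)))
      (List.replicate a 3 ++ List.replicate c 2) 0 (fun s hs => rep_mem hs)
      (by simp; omega) (by
        intro i j _ _
        simp only [rel, listBlocks, Matrix.of_apply, Nat.sub_zero]
        split_ifs with h <;> simp [h])
    rw [Rm_zero] at this
    refine ⟨this.1, ?_⟩
    rw [this.2]
    simp
    omega

theorem EP_addOne {α β : Type} {A : α → β → Prop} {R : Finset α} {C : Finset β} {i0 : α} {j0 : β}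
    (hi : i0 ∈ R) (hj : j0 ∈ C) (h : ¬ A i0 j0) (hJ : JS A R C) : EP (addOne A i0 j0) R C := by
  refine ⟨i0, hi, j0, hj, Or.inr ⟨rfl, rfl⟩, ?_⟩
  have : delOne (addOne A i0 j0) i0 j0 = A := by
    funext i j
    simp only [delOne, addOne, eq_iff_iff]
    grind
  rwa [this]

theorem list_EP {n a c : ℕ} (h : 3 * a + 2 * c = n) {i0 j0 : Fin n}
    (h0 : listBlocks n (List.replicate a 3 ++ List.replicate c 2) i0 j0 = 0) :
    EP (rel (setOne (listBlocks n (List.replicate a 3 ++ List.replicate c 2)) i0 j0))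
      Finset.univ Finset.univ := by
  obtain ⟨hz, hJ, _⟩ := list_JS h
  rw [(setOne_class hz h0).2.2]
  exact EP_addOne (Finset.mem_univ _) (Finset.mem_univ _) (by simp [rel, h0]) hJ

theorem head_rel_big {n m : ℕ} {B : Matrix (Fin m) (Fin m) ℕ} {L : List ℕ} (i j : Fin n)
    (hi : m ≤ i.val) (hj : m ≤ j.val) :
    rel (headBlocks n B L) i j ↔ blockIdx L (i - m) = blockIdx L (j - m) := by
  simp only [rel, headBlocks, Matrix.of_apply]
  rw [dif_neg (by omega)]
  simp [hi, hj]

theorem head_rel_off {n m : ℕ} {B : Matrix (Fin m) (Fin m) ℕ} {L : List ℕ} (i j : Fin n)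
    (h : rel (headBlocks n B L) i j) : m ≤ i.val ↔ m ≤ j.val := by
  by_contra hc
  simp only [rel, headBlocks, Matrix.of_apply] at h
  rw [dif_neg (by omega), if_neg (by omega)] at h
  exact absurd h (by simp)

theorem head_rel_small {n m : ℕ} {B : Matrix (Fin m) (Fin m) ℕ} {L : List ℕ} (i j : Fin n)
    (hi : i.val < m) (hj : j.val < m) :
    rel (headBlocks n B L) i j ↔ B ⟨i.val, hi⟩ ⟨j.val, hj⟩ = 1 := by
  simp only [rel, headBlocks, Matrix.of_apply]
  rw [dif_pos ⟨hi, hj⟩]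

theorem head_T {n a c : ℕ} (h : 4 + 3 * a + 2 * c = n) :
    ET (rel (headBlocks n T4 (List.replicate a 3 ++ List.replicate c 2)))
      Finset.univ Finset.univ := by
  set L := List.replicate a 3 ++ List.replicate c 2 with hL
  set A := rel (headBlocks n T4 L) with hA
  have off := fun i j => head_rel_off (n := n) (B := T4) (L := L) i j
  have small : ∀ i j : Fin n, i.val < 4 → j.val < 4 →
      (A i j ↔ (i.val < 3 ∧ j.val < 3 ∧ ¬ (i.val = 0 ∧ j.val = 0)) ∨ (i.val = 3 ∧ j.val = 3)) :=
    fun i j hi hj => (head_rel_small i j hi hj).trans (T4_apply _ _ hi hj)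
  refine ⟨⟨3, by omega⟩, ⟨3, by omega⟩, ⟨Finset.mem_univ _, Finset.mem_univ _, ?_⟩,
    Sm n 0 3, Sm n 0 3, ⟨?_, ?_, ?_⟩, ⟨Sm_card (by omega), Sm_card (by omega), ⟨0, by omega⟩, ?_,
      ⟨0, by omega⟩, ?_, ?_⟩, ?_⟩
  · intro i _ j _ hij
    simp only [Fin.ext_iff] at *
    have h1 := off i j
    have h2 := small i j
    by_cases hi : i.val < 4 <;> by_cases hj : j.val < 4
    · rw [h2 hi hj]; omega
    · have : ¬ A i j := fun hh => by have := h1 hh; omega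
      simp only [this, false_iff]; omega
    · have : ¬ A i j := fun hh => by have := h1 hh; omega
      simp only [this, false_iff]; omega
    · omega
  · intro i; simp only [Sm, Finset.mem_filter, Finset.mem_univ, true_and, Finset.mem_erase,
      Fin.ext_iff, ne_eq, and_true]
    omega
  · intro i; simp only [Sm, Finset.mem_filter, Finset.mem_univ, true_and, Finset.mem_erase,
      Fin.ext_iff, ne_eq, and_true]
    omega
  · intro i hi j hj hh
    simp only [Sm, Finset.mem_filter, Finset.mem_univ, true_and, Finset.mem_erase, Fin.ext_iff,
      ne_eq, and_true] at *
    have h1 := off i j hh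
    by_cases hi4 : i.val < 4
    · have := (small i j hi4 (by omega)).1 hh; omega
    · omega
  · simp [Sm]
  · simp [Sm]
  · intro i hi j hj
    simp only [Sm, Finset.mem_filter, Finset.mem_univ, true_and, Fin.ext_iff] at *
    rw [small i j (by omega) (by omega)]
    omega
  · have e : (Finset.univ.erase (⟨3, by omega⟩ : Fin n)) \ Sm n 0 3 = Rm n 4 := by
      ext i
      simp only [Sm, Rm, Finset.mem_filter, Finset.mem_univ, true_and, Finset.mem_erase, Fin.ext_iff,
        ne_eq, and_true, Finset.mem_sdiff]
      omega
    have := (concrete_JS (A := A) L 4 (fun s hs => rep_mem hs) (by simp [hL]; omega)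
      (fun i j hi hj => head_rel_big i j hi hj)).1
    rw [← e] at this
    convert this

theorem head_Q {n a c : ℕ} (h : 6 + 3 * a + 2 * c = n) :
    EH 4 (rel (headBlocks n Q6 (List.replicate a 3 ++ List.replicate c 2)))
      Finset.univ Finset.univ := by
  set L := List.replicate a 3 ++ List.replicate c 2 with hL
  set A := rel (headBlocks n Q6 L) with hA
  have off := fun i j => head_rel_off (n := n) (B := Q6) (L := L) i j
  have small : ∀ i j : Fin n, i.val < 6 → j.val < 6 →
      (A i j ↔ (i.val < 4 ∧ j.val < 4 ∧ ¬ (i.val = 0 ∧ j.val = 0)) ∨ (4 ≤ i.val ∧ 4 ≤ j.val)) :=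
    fun i j hi hj => (head_rel_small i j hi hj).trans (Q6_apply _ _ hi hj)
  refine ⟨Sm n 0 4, Sm n 0 4, ⟨Finset.subset_univ _, Finset.subset_univ _, ?_⟩,
    ⟨Sm_card (by omega), Sm_card (by omega), ⟨0, by omega⟩, ?_,
      ⟨0, by omega⟩, ?_, ?_⟩, ?_⟩
  · intro i _ j _ hh
    simp only [Sm, Finset.mem_filter, Finset.mem_univ, true_and, Fin.ext_iff] at *
    have h1 := off i j hh
    by_cases hi4 : i.val < 6
    · have := (small i j hi4 (by omega)).1 hh; omega
    · omega
  · simp [Sm]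
  · simp [Sm]
  · intro i hi j hj
    simp only [Sm, Finset.mem_filter, Finset.mem_univ, true_and, Fin.ext_iff] at *
    rw [small i j (by omega) (by omega)]
    omega
  · have e : Finset.univ \ Sm n 0 4 = Rm n 4 := by
      rw [← Rm_zero, Rm_sdiff]
    rw [e]
    refine (concrete_JS (A := A) (2 :: L) 4 ?_ (by simp [hL]; omega) ?_).1
    · intro s hs
      rw [List.mem_cons] at hs
      rcases hs with hs | hs
      · exact Or.inl hs
      · exact rep_mem hs
    · intro i j hi hj
      simp only [blockIdx]
      by_cases hi6 : i.val < 6 <;> by_cases hj6 : j.val < 6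
      · rw [small i j hi6 hj6, if_pos (by omega), if_pos (by omega)]; omega
      · have : ¬ A i j := fun hh => by have := off i j hh; omega
        rw [if_pos (by omega), if_neg (by omega)]
        simp only [this, false_iff]; omega
      · have : ¬ A i j := fun hh => by have := off i j hh; omega
        rw [if_neg (by omega), if_pos (by omega)]
        simp only [this, false_iff]; omega
      · rw [if_neg (by omega), if_neg (by omega),
          show A i j ↔ _ from head_rel_big i j (by omega) (by omega), Nat.sub_sub, Nat.sub_sub,
          show 4 + 2 = 6 from rfl]
        omega

end concrete

section enum
open scoped Classical
set_option linter.unusedSectionVars false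
set_option linter.unusedSimpArgs false
set_option linter.unusedVariables false

variable {α β : Type} [DecidableEq α] [DecidableEq β] [Nonempty α] [Nonempty β]

/-- an enumeration of `R × C` under which `A` becomes `r` -/
def Enum (A : α → β → Prop) (R : Finset α) (C : Finset β) (m : ℕ) (r : ℕ → ℕ → Prop) : Prop :=
  R.card = m ∧ C.card = m ∧ ∃ (f : ℕ → α) (g : ℕ → β), (∀ x < m, f x ∈ R) ∧ (∀ x < m, g x ∈ C) ∧
    (∀ x < m, ∀ y < m, f x = f y → x = y) ∧ (∀ x < m, ∀ y < m, g x = g y → x = y) ∧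
    ∀ x < m, ∀ y < m, (A (f x) (g y) ↔ r x y)

theorem Enum_congr {A : α → β → Prop} {R : Finset α} {C : Finset β} {m m' : ℕ}
    {r r' : ℕ → ℕ → Prop} (h : Enum A R C m r) (hm : m = m')
    (hr : ∀ x < m, ∀ y < m, (r x y ↔ r' x y)) : Enum A R C m' r' := by
  subst hm
  obtain ⟨h1, h2, f, g, h3, h4, h5, h6, h7⟩ := h
  exact ⟨h1, h2, f, g, h3, h4, h5, h6, fun x hx y hy => (h7 x hx y hy).trans (hr x hx y hy)⟩

theorem enum_set {S : Finset α} {m : ℕ} (h : S.card = m) :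
    ∃ f : ℕ → α, (∀ x < m, f x ∈ S) ∧ (∀ x < m, ∀ y < m, f x = f y → x = y) := by
  subst h
  refine ⟨fun x => if hx : x < S.card then (S.equivFin.symm ⟨x, hx⟩).val else Classical.arbitrary α,
    ?_, ?_⟩
  · intro x hx
    simp only [hx, dif_pos]
    exact (S.equivFin.symm ⟨x, hx⟩).2
  · intro x hx y hy h
    simp only [hx, hy, dif_pos] at h
    have := S.equivFin.symm.injective (Subtype.ext h)
    exact congrArg Fin.val this

theorem enum_set_first {S : Finset α} {m : ℕ} (h : S.card = m) {i0 : α} (hi : i0 ∈ S) :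
    ∃ f : ℕ → α, (∀ x < m, f x ∈ S) ∧ (∀ x < m, ∀ y < m, f x = f y → x = y) ∧ f 0 = i0 := by
  have h1 : (S.erase i0).card = m - 1 := by rw [Finset.card_erase_of_mem hi, h]
  obtain ⟨f, f1, f2⟩ := enum_set h1
  refine ⟨fun x => if x = 0 then i0 else f (x - 1), ?_, ?_, by simp⟩
  · intro x hx
    by_cases h0 : x = 0
    · simp [h0, hi]
    · simp only [h0, if_false]
      exact Finset.mem_of_mem_erase (f1 (x - 1) (by omega))
  · intro x hx y hy he
    by_cases hx0 : x = 0 <;> by_cases hy0 : y = 0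
    · omega
    · simp only [hx0, hy0, if_true, if_false] at he
      exact absurd he.symm (Finset.ne_of_mem_erase (f1 (y - 1) (by omega)))
    · simp only [hx0, hy0, if_true, if_false] at he
      exact absurd he (Finset.ne_of_mem_erase (f1 (x - 1) (by omega)))
    · simp only [hx0, hy0, if_false] at he
      have := f2 _ (by omega) _ (by omega) he
      omega

theorem Enum_full {A : α → β → Prop} {S : Finset α} {T : Finset β} {m : ℕ} (hS : S.card = m)
    (hT : T.card = m) (h : ∀ i ∈ S, ∀ j ∈ T, A i j) : Enum A S T m (fun _ _ => True) := by
  obtain ⟨f, f1, f2⟩ := enum_set hS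
  obtain ⟨g, g1, g2⟩ := enum_set hT
  exact ⟨hS, hT, f, g, f1, g1, f2, g2, fun x hx y hy => by simp [h _ (f1 x hx) _ (g1 y hy)]⟩

theorem Enum_HB {A : α → β → Prop} {S : Finset α} {T : Finset β} {m : ℕ} (h : HB A m S T) :
    Enum A S T m (fun x y => ¬ (x = 0 ∧ y = 0)) := by
  obtain ⟨hS, hT, i0, hi0, j0, hj0, h⟩ := h
  obtain ⟨f, f1, f2, f3⟩ := enum_set_first hS hi0
  obtain ⟨g, g1, g2, g3⟩ := enum_set_first hT hj0
  refine ⟨hS, hT, f, g, f1, g1, f2, g2, fun x hx y hy => ?_⟩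
  rw [h _ (f1 x hx) _ (g1 y hy)]
  have e1 : f x = i0 ↔ x = 0 := by
    constructor
    · intro e; exact f2 x hx 0 (by omega) (e.trans f3.symm)
    · rintro rfl; exact f3
  have e2 : g y = j0 ↔ y = 0 := by
    constructor
    · intro e; exact g2 y hy 0 (by omega) (e.trans g3.symm)
    · rintro rfl; exact g3
  rw [e1, e2]

theorem Enum_concat {A : α → β → Prop} {R : Finset α} {C : Finset β} {S : Finset α} {T : Finset β}
    {m m' : ℕ} {r1 r2 : ℕ → ℕ → Prop} (hs : Split A R C S T) (h1 : Enum A S T m r1)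
    (h2 : Enum A (R \ S) (C \ T) m' r2) :
    Enum A R C (m + m') (fun x y => (x < m ∧ y < m ∧ r1 x y) ∨
      (m ≤ x ∧ m ≤ y ∧ r2 (x - m) (y - m))) := by
  obtain ⟨s1, s2, s3⟩ := hs
  obtain ⟨c1, c2, f, g, f1, g1, f2, g2, e⟩ := h1
  obtain ⟨c1', c2', f', g', f1', g1', f2', g2', e'⟩ := h2
  have k1 := Finset.card_sdiff_add_card_eq_card s1
  have k2 := Finset.card_sdiff_add_card_eq_card s2
  refine ⟨by omega, by omega, fun x => if x < m then f x else f' (x - m),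
    fun x => if x < m then g x else g' (x - m), ?_, ?_, ?_, ?_, ?_⟩
  · intro x hx
    by_cases h : x < m
    · simp only [h, if_true]; exact s1 (f1 x h)
    · simp only [h, if_false]; exact (Finset.mem_sdiff.1 (f1' (x - m) (by omega))).1
  · intro x hx
    by_cases h : x < m
    · simp only [h, if_true]; exact s2 (g1 x h)
    · simp only [h, if_false]; exact (Finset.mem_sdiff.1 (g1' (x - m) (by omega))).1
  · intro x hx y hy he
    by_cases h : x < m <;> by_cases h' : y < m <;> simp only [h, h', if_true, if_false] at he
    · exact f2 x h y h' he
    · have := f1 x h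
      rw [he] at this
      exact absurd this (Finset.mem_sdiff.1 (f1' (y - m) (by omega))).2
    · have := f1 y h'
      rw [← he] at this
      exact absurd this (Finset.mem_sdiff.1 (f1' (x - m) (by omega))).2
    · have := f2' _ (by omega) _ (by omega) he
      omega
  · intro x hx y hy he
    by_cases h : x < m <;> by_cases h' : y < m <;> simp only [h, h', if_true, if_false] at he
    · exact g2 x h y h' he
    · have := g1 x h
      rw [he] at this
      exact absurd this (Finset.mem_sdiff.1 (g1' (y - m) (by omega))).2
    · have := g1 y h'
      rw [← he] at this
      exact absurd this (Finset.mem_sdiff.1 (g1' (x - m) (by omega))).2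
    · have := g2' _ (by omega) _ (by omega) he
      omega
  · intro x hx y hy
    by_cases h : x < m <;> by_cases h' : y < m <;> simp only [h, h', if_true, if_false]
    · rw [e x h y h']
      simp [Nat.not_le.2 h]
    · have a1 := f1 x h
      have a2 := Finset.mem_sdiff.1 (g1' (y - m) (by omega))
      have := s3 _ (s1 a1) _ a2.1
      simp only [a1, a2.2, true_iff, false_iff] at this
      replace this : ¬ A (f x) (g' (y - m)) := this
      simp [this, Nat.not_le.2 h]
    · have a1 := g1 y h'
      have a2 := Finset.mem_sdiff.1 (f1' (x - m) (by omega))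
      have := s3 _ a2.1 _ (s2 a1)
      simp only [a1, a2.2, iff_true, iff_false] at this
      replace this : ¬ A (f' (x - m)) (g y) := this
      simp [this, Nat.not_le.2 h']
    · rw [e' _ (by omega) _ (by omega)]
      simp [Nat.not_lt.1 h, Nat.not_lt.1 h']

/-- the relation of a list of blocks -/
def LR (L : List ℕ) : ℕ → ℕ → Prop := fun x y => blockIdx L x = blockIdx L y

theorem Enum_cons {A : α → β → Prop} {R : Finset α} {C : Finset β} {S : Finset α} {T : Finset β}
    {m : ℕ} {L : List ℕ} (hb : Block A R C S T) (h : Enum A (R \ S) (C \ T) m (LR L)) :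
    Enum A R C (T.card + m) (LR (T.card :: L)) := by
  refine Enum_congr (Enum_concat (Block_split hb) (Enum_full hb.2.2.1 rfl ?_) h) rfl ?_
  · intro i hi j hj
    rw [hb.2.2.2.2 i (hb.1 hi) j (hb.2.1 hj) (Or.inl hi)]
    exact ⟨hi, hj⟩
  · intro x _ y _
    simp only [LR, blockIdx]
    by_cases h : x < T.card <;> by_cases h' : y < T.card <;>
      simp [h, h', Nat.not_le.2, Nat.not_lt.1]

theorem Enum_empty (A : α → β → Prop) (r : ℕ → ℕ → Prop) : Enum A ∅ ∅ 0 r :=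
  ⟨by simp, by simp, fun _ => Classical.arbitrary α, fun _ => Classical.arbitrary β,
    by simp, by simp, by simp, by simp, by simp⟩

theorem JS2_enum (A : α → β → Prop) (n : ℕ) : ∀ (R : Finset α) (C : Finset β), R.card = n →
    C.card = n → JS A R C → (∀ S T, Block A R C S T → T.card = 2) →
    ∃ c, 2 * c = n ∧ Enum A R C n (LR (List.replicate c 2)) := by
  induction n using Nat.strong_induction_on with
  | _ n ih =>
    intro R C hR hC hJ h2
    rcases R.eq_empty_or_nonempty with rfl | ⟨i, hi⟩
    · have h0 : n = 0 := by rw [← hR]; simp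
      subst h0
      rw [Finset.card_eq_zero] at hC
      subst hC
      exact ⟨0, rfl, Enum_empty _ _⟩
    · obtain ⟨S, T, hb, _⟩ := hJ.1 i hi
      have hT := h2 S T hb
      have hS := hb.2.2.1
      have k1 := Finset.card_sdiff_add_card_eq_card hb.1
      have k2 := Finset.card_sdiff_add_card_eq_card hb.2.1
      obtain ⟨c, hc, he⟩ := ih (n - 2) (by omega) (R \ S) (C \ T) (by omega) (by omega)
        (JS_rem hb hJ) (fun S' T' hb' => h2 S' T' (Block_lift (Block_split hb) hb'))
      have := Enum_cons hb he
      rw [hT] at this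
      exact ⟨c + 1, by omega, Enum_congr this (by omega) (by simp [List.replicate_succ])⟩

theorem JS_enum (A : α → β → Prop) (n : ℕ) : ∀ (R : Finset α) (C : Finset β), R.card = n →
    C.card = n → JS A R C →
    ∃ a c, 3 * a + 2 * c = n ∧ Enum A R C n (LR (List.replicate a 3 ++ List.replicate c 2)) := by
  induction n using Nat.strong_induction_on with
  | _ n ih =>
    intro R C hR hC hJ
    by_cases h3 : ∃ S T, Block A R C S T ∧ T.card = 3
    · obtain ⟨S, T, hb, hT⟩ := h3
      have hS := hb.2.2.1
      have k1 := Finset.card_sdiff_add_card_eq_card hb.1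
      have k2 := Finset.card_sdiff_add_card_eq_card hb.2.1
      obtain ⟨a, c, hc, he⟩ := ih (n - 3) (by omega) (R \ S) (C \ T) (by omega) (by omega)
        (JS_rem hb hJ)
      have := Enum_cons hb he
      rw [hT] at this
      exact ⟨a + 1, c, by omega, Enum_congr this (by omega) (by simp [List.replicate_succ])⟩
    · obtain ⟨c, hc, he⟩ := JS2_enum A n R C hR hC hJ (fun S T hb => by
        rcases hb.2.2.2.1 with h | h
        · exact h
        · exact absurd ⟨S, T, hb, h⟩ h3)
      exact ⟨0, c, by omega, Enum_congr he rfl (by simp)⟩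

theorem ET_enum {A : α → β → Prop} {n : ℕ} {R : Finset α} {C : Finset β} (hR : R.card = n)
    (hC : C.card = n) (h : ET A R C) :
    ∃ a c, 4 + 3 * a + 2 * c = n ∧ Enum A R C n (fun x y =>
      (x < 4 ∧ y < 4 ∧ ((x < 3 ∧ y < 3 ∧ ¬ (x = 0 ∧ y = 0)) ∨ (x = 3 ∧ y = 3))) ∨
      (4 ≤ x ∧ 4 ≤ y ∧ LR (List.replicate a 3 ++ List.replicate c 2) (x - 4) (y - 4))) := by
  obtain ⟨i, j, ⟨hi, hj, hij⟩, S, T, ⟨s1, s2, s3⟩, hb, hJ⟩ := h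
  have e1 : (R.erase i) \ S = (R \ S) \ {i} := by
    ext x; simp only [Finset.mem_sdiff, Finset.mem_erase, Finset.mem_singleton]; tauto
  have e2 : (C.erase j) \ T = (C \ T) \ {j} := by
    ext x; simp only [Finset.mem_sdiff, Finset.mem_erase, Finset.mem_singleton]; tauto
  have hiS : i ∉ S := fun h => by simpa using s1 h
  have hjT : j ∉ T := fun h => by simpa using s2 h
  have hS := hb.1
  have hT := hb.2.1
  have k1 := Finset.card_sdiff_add_card_eq_card s1
  have k2 := Finset.card_sdiff_add_card_eq_card s2
  rw [Finset.card_erase_of_mem hi] at k1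
  rw [Finset.card_erase_of_mem hj] at k2
  have p1 := Finset.card_pos.2 ⟨i, hi⟩
  obtain ⟨a, c, hac, he⟩ := JS_enum A (n - 4) ((R.erase i) \ S) ((C.erase j) \ T)
    (by omega) (by omega) hJ
  rw [e1, e2] at he
  have sp1 : Split A (R \ S) (C \ T) {i} {j} := by
    refine ⟨by simp [hi, hiS], by simp [hj, hjT], ?_⟩
    intro x hx y hy hh
    rw [Finset.mem_sdiff] at hx hy
    have := hij x hx.1 y hy.1
    simp only [Finset.mem_singleton]
    tauto
  have sp2 : Split A R C S T := by
    refine ⟨s1.trans (Finset.erase_subset _ _), s2.trans (Finset.erase_subset _ _), ?_⟩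
    intro x hx y hy hh
    have h1 := hij x hx y hy
    have h2 := s3 x
    by_cases hxi : x = i
    · have : y = j := by tauto
      subst hxi this
      simp [hiS, hjT]
    · have hyj : y ≠ j := by tauto
      exact s3 x (by simp [hx, hxi]) y (by simp [hy, hyj]) hh
  have f1 : Enum A {i} {j} 1 (fun _ _ => True) := Enum_full (by simp) (by simp) (by
    intro x hx y hy
    rw [Finset.mem_singleton] at hx hy
    subst hx hy
    rw [hij x hi y hj (Or.inl rfl)]
    simp)
  have := Enum_concat sp2 (Enum_HB hb) (Enum_concat sp1 f1 he)
  refine ⟨a, c, by omega, Enum_congr this (by omega) ?_⟩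
  intro x hx y hy
  rw [Nat.sub_sub, Nat.sub_sub, show 3 + 1 = 4 from rfl]
  generalize LR _ (x - 4) (y - 4) = p
  by_cases hp : p
  · simp only [hp, and_true, and_false, or_false]; omega
  · simp only [hp, and_true, and_false, or_false]; omega

theorem EH_enum {A : α → β → Prop} {n : ℕ} {R : Finset α} {C : Finset β} (hR : R.card = n)
    (hC : C.card = n) (hsg : sg A R C < 3 * n) (h : EH 4 A R C) :
    ∃ a c, 6 + 3 * a + 2 * c = n ∧ Enum A R C n (fun x y =>
      (x < 6 ∧ y < 6 ∧ ((x < 4 ∧ y < 4 ∧ ¬ (x = 0 ∧ y = 0)) ∨ (4 ≤ x ∧ 4 ≤ y))) ∨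
      (6 ≤ x ∧ 6 ≤ y ∧ LR (List.replicate a 3 ++ List.replicate c 2) (x - 6) (y - 6))) := by
  obtain ⟨S, T, hs, hb, hJ⟩ := h
  have hS := hb.1
  have hT := hb.2.1
  have k1 := Finset.card_sdiff_add_card_eq_card hs.1
  have k2 := Finset.card_sdiff_add_card_eq_card hs.2.1
  have h2 : ∃ S' T', Block A (R \ S) (C \ T) S' T' ∧ T'.card = 2 := by
    by_contra hcon
    push Not at hcon
    have : ∀ i ∈ R, 3 ≤ rd A C i := by
      intro i hi
      by_cases hiS : i ∈ S
      · obtain ⟨_, _, i0, hi0, j0, hj0, hh⟩ := hb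
        have : T.erase j0 ⊆ C.filter (A i) := by
          intro j hj
          rw [Finset.mem_erase] at hj
          rw [Finset.mem_filter]
          refine ⟨hs.2.1 hj.2, ?_⟩
          rw [hh i hiS j hj.2]
          tauto
        have := Finset.card_le_card this
        rw [Finset.card_erase_of_mem hj0] at this
        unfold rd
        omega
      · obtain ⟨S', T', hb', hm⟩ := hJ.1 i (by simp [hi, hiS])
        rw [Block_rd (Block_lift hs hb') hm]
        have := hcon S' T' hb'
        have := hb'.2.2.2.1
        omega
    have := Finset.card_nsmul_le_sum R (fun i => rd A C i) 3 this
    unfold sg at hsg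
    rw [smul_eq_mul, hR] at this
    omega
  obtain ⟨S', T', hb', hT'⟩ := h2
  have hS' := hb'.2.2.1
  have k1' := Finset.card_sdiff_add_card_eq_card hb'.1
  have k2' := Finset.card_sdiff_add_card_eq_card hb'.2.1
  obtain ⟨a, c, hac, he⟩ := JS_enum A (n - 6) _ _ (by omega) (by omega) (JS_rem hb' hJ)
  have f1 : Enum A S' T' 2 (fun _ _ => True) := Enum_full (by omega) hT' (by
    intro i hi j hj
    rw [hb'.2.2.2.2 i (hb'.1 hi) j (hb'.2.1 hj) (Or.inl hi)]
    exact ⟨hi, hj⟩)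
  have := Enum_concat hs (Enum_HB hb) (Enum_concat (Block_split hb') f1 he)
  refine ⟨a, c, by omega, Enum_congr this (by omega) ?_⟩
  intro x hx y hy
  rw [Nat.sub_sub, Nat.sub_sub, show 4 + 2 = 6 from rfl]
  generalize LR _ (x - 6) (y - 6) = p
  by_cases hp : p
  · simp only [hp, and_true, and_false, or_false]; omega
  · simp only [hp, and_true, and_false, or_false]; omega

theorem Enum_equiv {n : ℕ} {A : Fin n → Fin n → Prop} {r : ℕ → ℕ → Prop}
    (hne : Nonempty (Fin n))
    (h : Enum A Finset.univ Finset.univ n r) :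
    ∃ e f : Equiv.Perm (Fin n), ∀ i j, (A (e i) (f j) ↔ r i j) := by
  obtain ⟨_, _, f, g, _, _, h1, h2, h3⟩ := h
  have b1 : Function.Injective (fun i : Fin n => f i.val) := fun i j hh =>
    Fin.ext (h1 _ i.2 _ j.2 hh)
  have b2 : Function.Injective (fun i : Fin n => g i.val) := fun i j hh =>
    Fin.ext (h2 _ i.2 _ j.2 hh)
  exact ⟨Equiv.ofBijective _ (Finite.injective_iff_bijective.1 b1),
    Equiv.ofBijective _ (Finite.injective_iff_bijective.1 b2), fun i j => h3 _ i.2 _ j.2⟩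

theorem zo_ext {n : ℕ} {A B : Matrix (Fin n) (Fin n) ℕ} (hA : IsZeroOne A) (hB : IsZeroOne B)
    {i j i' j' : Fin n} (h : rel A i j ↔ rel B i' j') : B i' j' = A i j := by
  unfold rel at h
  rcases hA i j with h1 | h1 <;> rcases hB i' j' with h2 | h2 <;> simp_all

theorem head_zo {n m : ℕ} {B : Matrix (Fin m) (Fin m) ℕ} (hB : IsZeroOne B) (L : List ℕ) :
    IsZeroOne (headBlocks n B L) := by
  intro i j
  simp only [headBlocks, Matrix.of_apply]
  split_ifs
  · exact hB _ _
  · simp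
  · simp

theorem T4_zo : IsZeroOne T4 := by
  intro i j
  fin_cases i <;> fin_cases j <;> simp [T4]

theorem Q6_zo : IsZeroOne Q6 := by
  intro i j
  fin_cases i <;> fin_cases j <;> simp [Q6]

theorem head_rel_all {n m : ℕ} {B : Matrix (Fin m) (Fin m) ℕ} {L : List ℕ} {s : ℕ → ℕ → Prop}
    (hs : ∀ x y (hx : x < m) (hy : y < m), B ⟨x, hx⟩ ⟨y, hy⟩ = 1 ↔ s x y) (i j : Fin n) :
    rel (headBlocks n B L) i j ↔ ((i.val < m ∧ j.val < m ∧ s i j) ∨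
      (m ≤ i.val ∧ m ≤ j.val ∧ LR L (i - m) (j - m))) := by
  by_cases hi : i.val < m <;> by_cases hj : j.val < m
  · rw [head_rel_small i j hi hj, hs]
    simp [hi, hj, Nat.not_le.2 hi]
  · have : ¬ rel (headBlocks n B L) i j := fun h => by have := head_rel_off i j h; omega
    simp [this, hi, hj, Nat.not_le.2 hi]
  · have : ¬ rel (headBlocks n B L) i j := fun h => by have := head_rel_off i j h; omega
    simp [this, hi, hj, Nat.not_le.2 hj]
  · rw [head_rel_big i j (by omega) (by omega)]
    simp [hi, hj, Nat.not_lt.1 hi, Nat.not_lt.1 hj, LR]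

theorem REq_head {n m : ℕ} (hn : 0 < n) {B : Matrix (Fin m) (Fin m) ℕ} {L : List ℕ}
    {s : ℕ → ℕ → Prop} {A : Matrix (Fin n) (Fin n) ℕ} (hA : IsZeroOne A) (hB : IsZeroOne B)
    (hs : ∀ x y (hx : x < m) (hy : y < m), B ⟨x, hx⟩ ⟨y, hy⟩ = 1 ↔ s x y)
    (h : ∀ _ : Nonempty (Fin n), Enum (rel A) Finset.univ Finset.univ n (fun x y => (x < m ∧ y < m ∧ s x y) ∨
      (m ≤ x ∧ m ≤ y ∧ LR L (x - m) (y - m)))) : REq A (headBlocks n B L) := by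
  have hne : Nonempty (Fin n) := ⟨⟨0, hn⟩⟩
  obtain ⟨e, f, hef⟩ := Enum_equiv hne (h hne)
  exact ⟨e, f, fun i j => zo_ext hA (head_zo hB L) ((hef i j).trans (head_rel_all hs i j).symm)⟩

theorem EP_REq {n : ℕ} (hn : 0 < n) {A : Matrix (Fin n) (Fin n) ℕ} (hA : IsZeroOne A)
    (h : EP (rel A) Finset.univ Finset.univ) :
    ∃ (a c : ℕ) (i0 j0 : Fin n), 3 * a + 2 * c = n ∧
      listBlocks n (List.replicate a 3 ++ List.replicate c 2) i0 j0 = 0 ∧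
      REq A (setOne (listBlocks n (List.replicate a 3 ++ List.replicate c 2)) i0 j0) := by
  have hne : Nonempty (Fin n) := ⟨⟨0, hn⟩⟩
  obtain ⟨i0, _, j0, _, h1, hJ⟩ := h
  obtain ⟨a, c, hac, he⟩ := JS_enum _ n Finset.univ Finset.univ (by simp) (by simp) hJ
  obtain ⟨e, f, hef⟩ := Enum_equiv hne he
  set M := listBlocks n (List.replicate a 3 ++ List.replicate c 2) with hM
  have hz : IsZeroOne M := (list_JS hac).1
  have hrel : ∀ i j, rel M i j ↔ delOne (rel A) i0 j0 (e i) (f j) := by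
    intro i j
    rw [hef i j]
    simp only [rel, hM, listBlocks, Matrix.of_apply, LR]
    split_ifs with h <;> simp [h]
  have h0 : M (e.symm i0) (f.symm j0) = 0 := by
    have := hrel (e.symm i0) (f.symm j0)
    simp only [delOne, Equiv.apply_symm_apply, true_and, not_true_eq_false, and_false, iff_false] at this
    rcases hz (e.symm i0) (f.symm j0) with h | h
    · exact h
    · exact absurd h (by simpa [rel] using this)
  refine ⟨a, c, e.symm i0, f.symm j0, hac, h0, e, f, fun i j => ?_⟩
  have hc := setOne_class hz h0
  apply zo_ext hA hc.1
  rw [hc.2.2, addOne, hrel, delOne, Equiv.eq_symm_apply, Equiv.eq_symm_apply]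
  by_cases h : e i = i0 ∧ f j = j0
  · simp [h.1, h.2, h1]
  · simp [h]

end enum

theorem exists_witness {n τ σ k m : ℕ} (h8 : 8 ≤ n) (hσ : σ + τ = n ^ 2)
    (hn : n = 3 * k + 2 * m + 2) (hs : σ = 9 * k + 4 * m + 5) :
    ∃ M ∈ Uclass n τ, perm M = 2 * 6 ^ k * 2 ^ m := by
  obtain ⟨hz, hJ, hsg⟩ := list_JS (n := n) (a := k) (c := m + 1) (by omega)
  set M := listBlocks n (List.replicate k 3 ++ List.replicate (m + 1) 2) with hM
  have hex : ∃ j, M ⟨0, by omega⟩ j = 0 := by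
    by_contra hcon
    push Not at hcon
    obtain ⟨S, T, hb, hm⟩ := hJ.1 ⟨0, by omega⟩ (Finset.mem_univ _)
    have hT : T = Finset.univ := by
      ext j
      simp only [Finset.mem_univ, iff_true]
      have h1 := hb.2.2.2.2 ⟨0, by omega⟩ (Finset.mem_univ _) j (Finset.mem_univ _) (Or.inl hm)
      refine (h1.1 ?_).2
      rcases hz ⟨0, by omega⟩ j with h | h
      · exact absurd h (hcon j)
      · exact h
    have := hb.2.2.2.1
    rw [hT, Finset.card_univ, Fintype.card_fin] at this
    omega
  obtain ⟨j0, hj0⟩ := hex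
  obtain ⟨c1, c2, c3⟩ := setOne_class hz hj0
  have hc := sg_zeroCount hz
  have hU : setOne M ⟨0, by omega⟩ j0 ∈ Uclass n τ := ⟨c1, by omega⟩
  refine ⟨_, hU, (matrix_main hσ hn hs hU).2.2 ?_⟩
  right; right
  exact list_EP (by omega) hj0

theorem stmt6 (n τ σ : ℕ) (hn : 8 ≤ n)
    (hτ1 : n ^ 2 - 3 * n ≤ τ) (hτ2 : τ ≤ n ^ 2 - 2 * n - 1)
    (hσ : σ = n ^ 2 - τ)
    (hmod : (σ - 2 * n) % 3 = 1) (hodd : Odd (3 * n - σ)) :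
    mu n τ = 2 * 6 ^ ((σ - 2 * n) / 3) * 2 ^ ((3 * n - σ) / 2) ∧
    ∀ A ∈ Uclass n τ, (perm A = mu n τ ↔
      ((∃ a c : ℕ, 4 + 3*a + 2*c = n ∧
          headBlocks n T4 (List.replicate a 3 ++ List.replicate c 2) ∈ Uclass n τ ∧
          CombEquiv A (headBlocks n T4 (List.replicate a 3 ++ List.replicate c 2))) ∨
       (∃ a c : ℕ, 6 + 3*a + 2*c = n ∧
          headBlocks n Q6 (List.replicate a 3 ++ List.replicate c 2) ∈ Uclass n τ ∧
          CombEquiv A (headBlocks n Q6 (List.replicate a 3 ++ List.replicate c 2))) ∨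
       (∃ (a c : ℕ) (i0 j0 : Fin n), 3 * a + 2 * c = n ∧
          listBlocks n (List.replicate a 3 ++ List.replicate c 2) ∈ Uclass n (τ + 1) ∧
          listBlocks n (List.replicate a 3 ++ List.replicate c 2) i0 j0 = 0 ∧
          CombEquiv A
            (setOne (listBlocks n (List.replicate a 3 ++ List.replicate c 2)) i0 j0)))) := by
  have hn2 : 8 * n ≤ n ^ 2 := by rw [sq]; exact Nat.mul_le_mul_right n hn
  obtain ⟨m, hm⟩ := hodd
  obtain ⟨k, hk⟩ : ∃ k, σ - 2 * n = 3 * k + 1 := ⟨(σ - 2 * n) / 3, by omega⟩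
  have e1 : (σ - 2 * n) / 3 = k := by omega
  have e2 : (3 * n - σ) / 2 = m := by omega
  have hN : n = 3 * k + 2 * m + 2 := by omega
  have hS : σ = 9 * k + 4 * m + 5 := by omega
  have hστ : σ + τ = n ^ 2 := by omega
  rw [e1, e2]
  have main := fun {M : Matrix (Fin n) (Fin n) ℕ} (hM : M ∈ Uclass n τ) =>
    matrix_main hστ hN hS hM
  have hmu : mu n τ = 2 * 6 ^ k * 2 ^ m := by
    apply IsGreatest.csSup_eq
    obtain ⟨M, hM, hp⟩ := exists_witness hn hστ hN hS
    refine ⟨⟨M, hM, hp⟩, ?_⟩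
    rintro _ ⟨M', hM', rfl⟩
    exact (main hM').1
  refine ⟨hmu, fun A hA => ?_⟩
  rw [hmu]
  have hcard : (Finset.univ : Finset (Fin n)).card = n := by simp
  have hne : Nonempty (Fin n) := ⟨⟨0, by omega⟩⟩
  constructor
  · intro hp
    rcases (main hA).2.1 hp with h | h | h
    · left
      obtain ⟨a, c, hac, he⟩ := ET_enum hcard hcard h
      have hr := REq_head (by omega) hA.1 T4_zo T4_apply (fun _ => he)
      exact ⟨a, c, hac, Uclass_REq hr hA, CombEquiv_of_REq hr⟩
    · right; left
      have hsg := sg_zeroCount hA.1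
      rw [hA.2] at hsg
      obtain ⟨a, c, hac, he⟩ := EH_enum (A := rel A) hcard hcard (by omega) h
      have hr := REq_head (by omega) hA.1 Q6_zo Q6_apply (fun _ => he)
      exact ⟨a, c, hac, Uclass_REq hr hA, CombEquiv_of_REq hr⟩
    · right; right
      obtain ⟨a, c, i0, j0, hac, h0, hr⟩ := EP_REq (by omega) hA.1 h
      have hz := (list_JS hac).1
      have hc := setOne_class hz h0
      have hU := Uclass_REq hr hA
      refine ⟨a, c, i0, j0, hac, ⟨hz, ?_⟩, h0, CombEquiv_of_REq hr⟩
      rw [hc.2.1, hU.2]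
  · rintro (⟨a, c, hac, hU, hC⟩ | ⟨a, c, hac, hU, hC⟩ | ⟨a, c, i0, j0, hac, hU, h0, hC⟩)
    · rw [← perm_CombEquiv hC]
      exact (main hU).2.2 (Or.inl (head_T hac))
    · rw [← perm_CombEquiv hC]
      exact (main hU).2.2 (Or.inr (Or.inl (head_Q hac)))
    · rw [← perm_CombEquiv hC]
      have hc := setOne_class hU.1 h0
      have hU' : setOne (listBlocks n (List.replicate a 3 ++ List.replicate c 2)) i0 j0 ∈
          Uclass n τ := ⟨hc.1, by have := hc.2.1; rw [hU.2] at this; omega⟩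
      exact (main hU').2.2 (Or.inr (Or.inr (list_EP hac h0)))

end BGM
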